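/- Law of data reconstruction for random features (Theorem 1). Under the random features setup and the data, activation, and scaling assumptions: for every η > 0 and every k > 0 there exists D such that for all d ≥ D, with probability at least 1 − d^{−k} over the random features matrix V and the training data x_1, …, x_n, the following holds simultaneously for every matrix X̂ ∈ ℝ^{n×d} whose rows x̂_1, …, x̂_n satisfy ‖x̂_j‖_2 = √d for all j and such that φ(x_i) ∈ span{φ(x̂_1), …, φ(x̂_n)} for every i ∈ [n]: for every ĵ ∈ [n] there exists i ∈ [n] with ‖x̂_ĵ − x_i‖_2 ≤ η √d. -/

import Mathlib

open MeasureTheory ProbabilityTheory Filter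

noncomputable section

/-- Euclidean (ℓ²) norm of a vector in `Fin m → ℝ`. -/
def eNorm {m : ℕ} (x : Fin m → ℝ) : ℝ := Real.sqrt (∑ j, (x j) ^ 2)

/-- Euclidean dot product. -/
def dotp {m : ℕ} (u v : Fin m → ℝ) : ℝ := ∑ j, u j * v j

/-- The random-features map `x ↦ (φ(vₖᵀx))ₖ`, where `vₖ` is the `k`-th row of `V`. -/
def featureMap {p d : ℕ} (φ : ℝ → ℝ) (V : Fin p → Fin d → ℝ) (x : Fin d → ℝ) :
    Fin p → ℝ := fun k => φ (dotp (V k) x)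

/-- The `l`-th normalized probabilists' Hermite polynomial (orthonormal in `L²(N(0,1))`). -/
def hermiteFn (l : ℕ) (x : ℝ) : ℝ :=
  (Polynomial.aeval x (Polynomial.hermite l)) / Real.sqrt (Nat.factorial l)

/-- The `l`-th Hermite coefficient `μ_l` of `φ`. -/
def hermiteCoeff (φ : ℝ → ℝ) (l : ℕ) : ℝ :=
  ∫ g, φ g * hermiteFn l g ∂(gaussianReal 0 1)

/-- The nonlinear part of the feature map: `φ̃(x) = (φ(vₖᵀx) − μ₁ vₖᵀx)ₖ`. -/
def tfeatureMap {p d : ℕ} (φ : ℝ → ℝ) (V : Fin p → Fin d → ℝ) (x : Fin d → ℝ) :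
    Fin p → ℝ := fun k => φ (dotp (V k) x) - hermiteCoeff φ 1 * dotp (V k) x

/-- `μ̃² := Σ_{l ≥ 3} μ_l²`. -/
def tmu2 (φ : ℝ → ℝ) : ℝ := ∑' l : ℕ, if 3 ≤ l then (hermiteCoeff φ l) ^ 2 else 0

/-- The law of the random features matrix: i.i.d. entries `N(0, 1/d)`. -/
def gaussianMatrix (p d : ℕ) : Measure (Fin p → Fin d → ℝ) :=
  Measure.pi fun _ => Measure.pi fun _ => gaussianReal 0 ((d : NNReal))⁻¹

/-- Sub-Gaussian norm of a distribution on `ℝ^d`: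
`sup_{‖u‖₂ = 1} inf { t > 0 : E exp((uᵀx)²/t²) ≤ 2 }`. -/
def vecSubGNorm {d : ℕ} (P : Measure (Fin d → ℝ)) : ℝ :=
  ⨆ u : {u : Fin d → ℝ // eNorm u = 1},
    sInf {t : ℝ | 0 < t ∧ ∫ x, Real.exp ((dotp u.1 x) ^ 2 / t ^ 2) ∂P ≤ 2}

/-- Data assumption: `P` is a probability distribution on `ℝ^d` with `‖x‖₂ = √d` a.s.
and sub-Gaussian norm at most `K`. -/
structure DataAssumption {d : ℕ} (P : Measure (Fin d → ℝ)) (K : ℝ) : Prop where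
  prob : IsProbabilityMeasure P
  norm_eq : ∀ᵐ x ∂P, eNorm x = Real.sqrt d
  subg : vecSubGNorm P ≤ K

/-- Core activation assumption: `φ` is non-linear, Lipschitz, with Lipschitz derivative,
`μ₀ = μ₂ = 0` and `μ₁ ≠ 0`. -/
structure ActivationAssumptionCore (φ : ℝ → ℝ) : Prop where
  nonlinear : ¬ ∃ a b : ℝ, ∀ z, φ z = a * z + b
  lipschitz : ∃ L : NNReal, LipschitzWith L φ
  differentiable : Differentiable ℝ φ
  deriv_lipschitz : ∃ L' : NNReal, LipschitzWith L' (deriv φ)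
  mu0 : hermiteCoeff φ 0 = 0
  mu2 : hermiteCoeff φ 2 = 0
  mu1 : hermiteCoeff φ 1 ≠ 0

/-- Full activation assumption: additionally, there are two non-zero Hermite coefficients
of order ≥ 3 with different parity. -/
structure ActivationAssumption (φ : ℝ → ℝ) extends ActivationAssumptionCore φ : Prop where
  parity : ∃ l l' : ℕ, 3 ≤ l ∧ 3 ≤ l' ∧ l % 2 ≠ l' % 2 ∧
    hermiteCoeff φ l ≠ 0 ∧ hermiteCoeff φ l' ≠ 0

/-! ### Gaussian integrals of polynomials -/

abbrev gam : Measure ℝ := gaussianReal 0 1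

lemma integrable_pow_gam (k : ℕ) : Integrable (fun x : ℝ => x ^ k) gam := by
  rcases Nat.eq_zero_or_pos k with rfl | hk
  · simp
  have h := (memLp_id_gaussianReal (μ := 0) (v := 1) (k : NNReal))
  have h2 := h.integrable_norm_pow (by simpa using hk.ne')
  refine h2.mono' (by fun_prop) (ae_of_all _ fun x => ?_)
  simp

lemma integrable_poly_gam (q : Polynomial ℝ) : Integrable (fun x : ℝ => q.eval x) gam := by
  induction q using Polynomial.induction_on' with
  | add p q hp hq =>
    simp only [Polynomial.eval_add]
    exact hp.add hq
  | monomial n a => simpa using (integrable_pow_gam n).const_mul a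

lemma integrable_poly_pdf (q : Polynomial ℝ) :
    Integrable (fun x : ℝ => gaussianPDFReal 0 1 x * q.eval x) := by
  have h := integrable_poly_gam q
  rw [gam, gaussianReal_of_var_ne_zero _ one_ne_zero,
    integrable_withDensity_iff_integrable_smul' (measurable_gaussianPDF _ _)
      (ae_of_all _ fun _ => gaussianPDF_lt_top)] at h
  simpa using h

lemma hasDerivAt_pdf (x : ℝ) :
    HasDerivAt (gaussianPDFReal 0 1) (-x * gaussianPDFReal 0 1 x) x := by
  have h : HasDerivAt (fun x : ℝ => (√(2 * Real.pi * (1:NNReal)))⁻¹ * Real.exp (-(x - 0) ^ 2 / (2 * (1:NNReal))))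
      ((√(2 * Real.pi * (1:NNReal)))⁻¹ * (Real.exp (-(x - 0) ^ 2 / (2 * (1:NNReal))) * (-x))) x := by
    refine HasDerivAt.const_mul _ (HasDerivAt.exp ?_)
    have := ((hasDerivAt_pow 2 x).neg).div_const (2:ℝ)
    convert! this using 1
    · funext y; simp
    · simp; ring
  rw [gaussianPDFReal_def]
  convert! h using 1
  ring

lemma gam_ibp (q : Polynomial ℝ) :
    ∫ x, x * q.eval x ∂gam = ∫ x, q.derivative.eval x ∂gam := by
  rw [integral_gaussianReal_eq_integral_smul one_ne_zero,
    integral_gaussianReal_eq_integral_smul one_ne_zero]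
  have h1 := integrable_poly_pdf q
  have h2 := integrable_poly_pdf q.derivative
  have h3 := integrable_poly_pdf (Polynomial.X * q)
  have key := integral_eq_zero_of_hasDerivAt_of_integrable
    (f := fun x => gaussianPDFReal 0 1 x * q.eval x)
    (f' := fun x => gaussianPDFReal 0 1 x * q.derivative.eval x
      - gaussianPDFReal 0 1 x * (Polynomial.X * q).eval x)
    (fun x => by
      have := (hasDerivAt_pdf x).mul (q.hasDerivAt x)
      convert! this using 1
      simp; ring) (h2.sub h3) h1
  rw [integral_sub h2 h3] at key
  simp only [smul_eq_mul]
  simp at key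
  linarith

/-- real Hermite polynomials -/
def hR (l : ℕ) : Polynomial ℝ := (Polynomial.hermite l).map (Int.castRingHom ℝ)

lemma hR_zero : hR 0 = 1 := by simp [hR]

lemma hR_succ (l : ℕ) : hR (l + 1) = Polynomial.X * hR l - (hR l).derivative := by
  simp [hR, Polynomial.hermite_succ, Polynomial.derivative_map]

lemma hR_deriv (l : ℕ) : (hR (l + 1)).derivative = ((l : ℝ) + 1) • hR l := by
  induction l with
  | zero => simp [hR_succ, hR_zero]
  | succ l ih =>
    rw [hR_succ (l + 1)]
    simp only [Polynomial.derivative_sub, Polynomial.derivative_mul, Polynomial.derivative_X, ih,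
      Polynomial.derivative_smul]
    rw [hR_succ l]
    ext k
    simp
    ring

lemma hermiteFn_eq (l : ℕ) (x : ℝ) :
    hermiteFn l x = (hR l).eval x / Real.sqrt (Nat.factorial l) := by
  rw [hermiteFn, hR, Polynomial.eval_map, Polynomial.aeval_def]
  rfl

lemma hR_step (n : ℕ) (q : Polynomial ℝ) :
    ∫ x, (hR (n+1)).eval x * q.eval x ∂gam = ∫ x, (hR n).eval x * q.derivative.eval x ∂gam := by
  have h := gam_ibp (hR n * q)
  have e1 : ∫ x, (hR (n+1)).eval x * q.eval x ∂gam
      = ∫ x, x * (hR n * q).eval x ∂gam - ∫ x, ((hR n).derivative * q).eval x ∂gam := by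
    rw [← integral_sub]
    · congr 1; funext x; simp [hR_succ]; ring
    · have := integrable_poly_gam (Polynomial.X * (hR n * q))
      simp only [Polynomial.eval_mul, Polynomial.eval_X] at this ⊢
      exact this
    · exact integrable_poly_gam _
  have e2 : ∫ x, (hR n * q).derivative.eval x ∂gam =
      ∫ x, ((hR n).derivative * q).eval x ∂gam + ∫ x, (hR n).eval x * q.derivative.eval x ∂gam := by
    rw [← integral_add]
    · congr 1; funext x; simp [Polynomial.derivative_mul]
    · exact integrable_poly_gam _
    · simpa using integrable_poly_gam (hR n * q.derivative)
  rw [e1, h, e2]; ring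

lemma hR_orth (n m : ℕ) :
    ∫ x, (hR n).eval x * (hR m).eval x ∂gam = if n = m then (n.factorial : ℝ) else 0 := by
  induction n generalizing m with
  | zero =>
    cases m with
    | zero => simp [hR_zero]
    | succ m =>
      have := hR_step m (hR 0)
      simp only [mul_comm] at this ⊢
      rw [this]; simp [hR_zero]
  | succ n ih =>
    cases m with
    | zero => rw [hR_step]; simp [hR_zero]
    | succ m =>
      rw [hR_step, hR_deriv]
      have : ∀ x, (hR n).eval x * (((m:ℝ)+1) • hR m).eval x = ((m:ℝ)+1) * ((hR n).eval x * (hR m).eval x) := by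
        intro x; simp; ring
      simp_rw [this, integral_const_mul, ih]
      by_cases h : n = m
      · subst h; simp [Nat.factorial_succ]
      · simp [h]

lemma hR_mehler {ρ s : ℝ} (h : ρ ^ 2 + s ^ 2 = 1) (l : ℕ) (g : ℝ) :
    ∫ z, (hR l).eval (ρ * g + s * z) ∂gam = ρ ^ l * (hR l).eval g := by
  have hIntg : ∀ q : Polynomial ℝ, Integrable (fun z => q.eval (ρ * g + s * z)) gam := by
    intro q
    have := integrable_poly_gam (q.comp (Polynomial.C (ρ * g) + Polynomial.C s * Polynomial.X))
    simpa using this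
  have hibp : ∀ q : Polynomial ℝ, ∫ z, z * q.eval (ρ * g + s * z) ∂gam =
      s * ∫ z, q.derivative.eval (ρ * g + s * z) ∂gam := by
    intro q
    have := gam_ibp (q.comp (Polynomial.C (ρ * g) + Polynomial.C s * Polynomial.X))
    simp only [Polynomial.eval_comp, Polynomial.derivative_comp, Polynomial.eval_add,
      Polynomial.eval_mul, Polynomial.eval_C, Polynomial.eval_X] at this
    rw [this, ← integral_const_mul]
    congr 1; funext z; simp
  have hstep : ∀ l, ∫ z, (hR (l+1)).eval (ρ * g + s * z) ∂gam =
      ρ * g * ∫ z, (hR l).eval (ρ * g + s * z) ∂gam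
        - ρ ^ 2 * ∫ z, (hR l).derivative.eval (ρ * g + s * z) ∂gam := by
    intro l
    have e : ∀ z, (hR (l+1)).eval (ρ * g + s * z) = ρ * g * (hR l).eval (ρ * g + s * z)
      + s * (z * (hR l).eval (ρ * g + s * z)) - (hR l).derivative.eval (ρ * g + s * z) := by
      intro z; rw [hR_succ]; simp; ring
    have i2 : Integrable (fun z => s * (z * (hR l).eval (ρ * g + s * z))) gam := by
      have := integrable_poly_gam (Polynomial.X * (hR l).comp (Polynomial.C (ρ * g) + Polynomial.C s * Polynomial.X))
      simpa using this.const_mul s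
    simp_rw [e]
    have i3 : Integrable (fun z => ρ * g * (hR l).eval (ρ * g + s * z) + s * (z * (hR l).eval (ρ * g + s * z))) gam :=
      ((hIntg _).const_mul _).add i2
    rw [integral_sub i3 (hIntg _),
      integral_add ((hIntg _).const_mul _) i2, integral_const_mul, integral_const_mul, hibp]
    linear_combination (∫ z, (hR l).derivative.eval (ρ * g + s * z) ∂gam) * h
  induction l using Nat.strong_induction_on with
  | _ l ih =>
    rcases l with _ | l
    · simp [hR_zero]
    · rw [hstep, ih l (by omega)]
      rcases l with _ | l
      · simp [hR_zero, hR_succ]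
      · rw [hR_deriv]
        have : ∀ z, (((l:ℝ)+1) • hR l).eval (ρ * g + s * z) = ((l:ℝ)+1) * (hR l).eval (ρ * g + s * z) := by
          intro x; simp
        simp_rw [this, integral_const_mul]
        rw [ih l (by omega), hR_succ (l+1), hR_deriv]
        simp; ring

/-! ### Joint law of two projections -/

/-- law of one row of the feature matrix -/
abbrev rowM (d : ℕ) : Measure (Fin d → ℝ) := Measure.pi fun _ : Fin d => gaussianReal 0 ((d : NNReal))⁻¹

/-- dot product as a continuous linear map -/
def dotL {d : ℕ} (x : Fin d → ℝ) : (Fin d → ℝ) →L[ℝ] ℝ :=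
  ∑ j, x j • ContinuousLinearMap.proj (R := ℝ) (φ := fun _ : Fin d => ℝ) j

lemma dotL_apply {d : ℕ} (x v : Fin d → ℝ) : dotL x v = dotp v x := by
  simp [dotL, dotp, mul_comm]

lemma measurable_dotp {d : ℕ} (x : Fin d → ℝ) : Measurable (fun v : Fin d → ℝ => dotp v x) := by
  unfold dotp; fun_prop

lemma charFunDual_gr (v : NNReal) (M : StrongDual ℝ ℝ) :
    charFunDual (gaussianReal 0 v) M = Complex.exp (-(v * (M 1) ^ 2 / 2 : ℝ)) := by
  have : charFunDual (gaussianReal 0 v) M = charFun (gaussianReal 0 v) (M 1) := by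
    rw [charFunDual_apply, charFun_apply_real]
    congr 1; funext x
    have : M x = M 1 * x := by
      have := M.map_smul x 1
      simp at this
      rw [this]; ring
    rw [this]; push_cast; ring_nf
  rw [this, charFun_gaussianReal]
  push_cast; ring_nf

lemma joint_law {d : ℕ} (hd : 0 < d) (x y : Fin d → ℝ) (hx : dotp x x = d) (hy : dotp y y = d)
    {ρ s : ℝ} (hρ : dotp x y = ρ * d) (h : ρ ^ 2 + s ^ 2 = 1) :
    (rowM d).map (fun v => (dotp v x, dotp v y)) =
      (gam.prod gam).map (fun q : ℝ × ℝ => (q.1, ρ * q.1 + s * q.2)) := by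
  have hd' : (d : ℝ) ≠ 0 := by positivity
  let T : (Fin d → ℝ) →L[ℝ] ℝ × ℝ := (dotL x).prod (dotL y)
  let S : (ℝ × ℝ) →L[ℝ] ℝ × ℝ := (ContinuousLinearMap.fst ℝ ℝ ℝ).prod
    (ρ • ContinuousLinearMap.fst ℝ ℝ ℝ + s • ContinuousLinearMap.snd ℝ ℝ ℝ)
  have hT : (fun v => (dotp v x, dotp v y)) = T := by
    funext v; simp [T, dotL_apply]
  have hS : (fun q : ℝ × ℝ => (q.1, ρ * q.1 + s * q.2)) = S := by
    funext q; simp [S]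
  rw [hT, hS]
  have : IsProbabilityMeasure ((rowM d).map T) := Measure.isProbabilityMeasure_map (by fun_prop)
  have : IsProbabilityMeasure ((gam.prod gam).map S) := Measure.isProbabilityMeasure_map (by fun_prop)
  apply Measure.ext_of_charFunDual
  funext L
  rw [charFunDual_map, charFunDual_map, charFunDual_pi, charFunDual_prod]
  simp_rw [charFunDual_gr]
  rw [← Complex.exp_sum, ← Complex.exp_add]
  congr 1
  rw [← Complex.ofReal_neg, ← Complex.ofReal_neg, ← Complex.ofReal_add]
  simp_rw [← Complex.ofReal_neg]
  rw [← Complex.ofReal_sum]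
  congr 1
  have hL : ∀ a b : ℝ, L (a, b) = a * L (1, 0) + b * L (0, 1) := by
    intro a b
    have : ((a, b) : ℝ × ℝ) = a • (1, 0) + b • (0, 1) := by simp
    rw [this, L.map_add, L.map_smul, L.map_smul]; simp
  set α := L (1, 0)
  set β := L (0, 1)
  have e1 : ∀ i, (L.comp T).comp (ContinuousLinearMap.single ℝ (fun _ : Fin d => ℝ) i) 1
      = x i * α + y i * β := by
    intro i
    have : T (Pi.single i 1) = (x i, y i) := by
      simp [T, dotL_apply, dotp, Pi.single_apply]
    simp only [ContinuousLinearMap.comp_apply, ContinuousLinearMap.single_apply]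
    rw [this, hL]
  have e2 : (L.comp S).comp (ContinuousLinearMap.inl ℝ ℝ ℝ) 1 = α + ρ * β := by
    have : S (1, 0) = (1, ρ) := by simp [S]
    simp only [ContinuousLinearMap.comp_apply, ContinuousLinearMap.inl_apply]
    rw [this, hL]; ring
  have e3 : (L.comp S).comp (ContinuousLinearMap.inr ℝ ℝ ℝ) 1 = s * β := by
    have : S (0, 1) = (0, s) := by simp [S]
    simp only [ContinuousLinearMap.comp_apply, ContinuousLinearMap.inr_apply]
    rw [this, hL]; ring
  rw [e2, e3]
  simp_rw [e1]
  have e4 : ∑ i, (x i * α + y i * β) ^ 2 = d * (α ^ 2 + 2 * ρ * α * β + β ^ 2) := by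
    have : ∑ i, (x i * α + y i * β) ^ 2
        = α ^ 2 * dotp x x + 2 * α * β * dotp x y + β ^ 2 * dotp y y := by
      simp only [dotp, Finset.mul_sum, ← Finset.sum_add_distrib]
      congr 1; funext i; ring
    rw [this, hx, hy, hρ]; ring
  have e5 : ∑ i, -(((d : NNReal)⁻¹ : NNReal) * (x i * α + y i * β) ^ 2 / 2 : ℝ)
      = -((d:ℝ)⁻¹ / 2) * ∑ i, (x i * α + y i * β) ^ 2 := by
    rw [Finset.mul_sum]; congr 1; funext i; push_cast; ring
  rw [e5, e4]
  field_simp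
  push_cast
  linear_combination (β^2) * h

lemma mp_dot {d : ℕ} (hd : 0 < d) (x : Fin d → ℝ) (hx : dotp x x = d) :
    MeasurePreserving (fun v => dotp v x) (rowM d) gam := by
  refine ⟨measurable_dotp x, ?_⟩
  have h := joint_law hd x x hx hx (ρ := 1) (s := 0) (by simpa using hx) (by norm_num)
  have h2 := congrArg (fun m => Measure.map Prod.fst m) h
  rw [Measure.map_map measurable_fst ((measurable_dotp x).prodMk (measurable_dotp x)),
    Measure.map_map measurable_fst (by fun_prop)] at h2
  have : (Prod.fst ∘ fun q : ℝ × ℝ => (q.1, (1:ℝ) * q.1 + 0 * q.2)) = Prod.fst := rfl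
  rw [this, Measure.map_fst_prod] at h2
  rw [measure_univ, one_smul] at h2
  exact h2

lemma memLp_poly (q : Polynomial ℝ) : MemLp (fun t => q.eval t) 2 gam := by
  rw [memLp_two_iff_integrable_sq (by exact q.continuous.aestronglyMeasurable)]
  have := integrable_poly_gam (q ^ 2)
  simp only [Polynomial.eval_pow] at this
  exact this

lemma expect_hermite {d : ℕ} (hd : 0 < d) (x y : Fin d → ℝ) (hx : dotp x x = d) (hy : dotp y y = d)
    {ρ s : ℝ} (hρ : dotp x y = ρ * d) (h : ρ ^ 2 + s ^ 2 = 1) (ψ : ℝ → ℝ) (hψ : MemLp ψ 2 gam)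
    (hψm : Measurable ψ) (l : ℕ) :
    ∫ v, ψ (dotp v x) * (hR l).eval (dotp v y) ∂(rowM d) = ρ ^ l * ∫ g, ψ g * (hR l).eval g ∂gam := by
  have m1 : MemLp (fun v => ψ (dotp v x)) 2 (rowM d) := hψ.comp_measurePreserving (mp_dot hd x hx)
  have m2 : MemLp (fun v => (hR l).eval (dotp v y)) 2 (rowM d) :=
    (memLp_poly (hR l)).comp_measurePreserving (mp_dot hd y hy)
  have hi : Integrable (fun v => ψ (dotp v x) * (hR l).eval (dotp v y)) (rowM d) :=
    m1.integrable_mul m2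
  have hc := (hR l).continuous
  let F : ℝ × ℝ → ℝ := fun q => ψ q.1 * (hR l).eval q.2
  have hF : Measurable F := (hψm.comp measurable_fst).mul (hc.measurable.comp measurable_snd)
  have mm : Measurable (fun v : Fin d → ℝ => (dotp v x, dotp v y)) :=
    (measurable_dotp x).prodMk (measurable_dotp y)
  have mS : Measurable (fun q : ℝ × ℝ => (q.1, ρ * q.1 + s * q.2)) := by fun_prop
  have hlaw := joint_law hd x y hx hy hρ h
  have hi2 : Integrable F ((rowM d).map (fun v => (dotp v x, dotp v y))) :=
    (integrable_map_measure hF.aestronglyMeasurable mm.aemeasurable).2 hi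
  have e0 : ∫ v, ψ (dotp v x) * (hR l).eval (dotp v y) ∂(rowM d)
      = ∫ q, F q ∂((rowM d).map (fun v => (dotp v x, dotp v y))) := by
    rw [integral_map mm.aemeasurable hF.aestronglyMeasurable]
  rw [e0, hlaw, integral_map mS.aemeasurable hF.aestronglyMeasurable]
  rw [hlaw] at hi2
  have hi3 := (integrable_map_measure hF.aestronglyMeasurable mS.aemeasurable).1 hi2
  rw [show (fun q : ℝ × ℝ => F (q.1, ρ * q.1 + s * q.2)) = (F ∘ fun q : ℝ × ℝ => (q.1, ρ * q.1 + s * q.2)) from rfl,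
    integral_prod _ hi3]
  simp only [F, Function.comp]
  simp_rw [integral_const_mul, hR_mehler h, ← integral_const_mul]
  congr 1; funext g; ring

/-- the two-term kernel -/
def ker2 (A B : ℝ) (l l' : ℕ) (ρ : ℝ) : ℝ := A * ρ ^ l + B * ρ ^ l'

lemma kernel_lower {φ : ℝ → ℝ} (hφ : MemLp φ 2 gam) (hφm : Measurable φ) {l l' : ℕ} (hl : l ≠ l')
    {d m : ℕ} (hd : 0 < d) (y : Fin m → Fin d → ℝ) (hy : ∀ i, dotp (y i) (y i) = d)
    (θ : Fin m → ℝ) :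
    ∑ i, ∑ j, θ i * θ j * ker2 (hermiteCoeff φ l ^ 2) (hermiteCoeff φ l' ^ 2) l l'
        (dotp (y i) (y j) / d)
      ≤ ∫ v, (∑ i, θ i * φ (dotp v (y i))) ^ 2 ∂(rowM d) := by
  have hd' : (d : ℝ) ≠ 0 := by positivity
  set a := hermiteCoeff φ l with ha
  set b := hermiteCoeff φ l' with hb
  let w : ℝ → ℝ := fun t => a * hermiteFn l t + b * hermiteFn l' t
  have hfl : Real.sqrt (Nat.factorial l) ≠ 0 := by positivity
  have hfl' : Real.sqrt (Nat.factorial l') ≠ 0 := by positivity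
  have hw : w = fun t => (a / Real.sqrt (Nat.factorial l)) * (hR l).eval t
      + (b / Real.sqrt (Nat.factorial l')) * (hR l').eval t := by
    funext t; simp only [w, hermiteFn_eq]; ring
  have hwL : MemLp w 2 gam := by
    rw [hw]; exact ((memLp_poly _).const_mul _).add ((memLp_poly _).const_mul _)
  have hwm : Measurable w := by
    rw [hw]
    exact (((hR l).continuous.measurable.const_mul _)).add ((hR l').continuous.measurable.const_mul _)
  have hrho : ∀ i j, ∃ s : ℝ, (dotp (y i) (y j) / d) ^ 2 + s ^ 2 = 1 := by
    intro i j
    have hcs : (dotp (y i) (y j)) ^ 2 ≤ (d:ℝ) ^ 2 := by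
      have := Finset.sum_mul_sq_le_sq_mul_sq Finset.univ (y i) (y j)
      have e1 := hy i
      have e2 := hy j
      simp only [dotp, ← pow_two] at e1 e2
      rw [e1, e2] at this
      simpa [dotp, pow_two] using this
    refine ⟨Real.sqrt (1 - (dotp (y i) (y j) / d) ^ 2), ?_⟩
    rw [Real.sq_sqrt]
    · ring
    · rw [div_pow, sub_nonneg, div_le_one (by positivity)]; exact hcs
  -- cross expectations
  have cross : ∀ ψ : ℝ → ℝ, MemLp ψ 2 gam → Measurable ψ → hermiteCoeff ψ l = a →
      hermiteCoeff ψ l' = b → ∀ i j, ∫ v, ψ (dotp v (y i)) * w (dotp v (y j)) ∂(rowM d)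
        = ker2 (a ^ 2) (b ^ 2) l l' (dotp (y i) (y j) / d) := by
    intro ψ hψ hψm h1 h2 i j
    obtain ⟨s, hs⟩ := hrho i j
    have hr : dotp (y i) (y j) = (dotp (y i) (y j) / d) * d := by field_simp
    have E := expect_hermite hd (y i) (y j) (hy i) (hy j) hr hs ψ hψ hψm
    have m1 : MemLp (fun v => ψ (dotp v (y i))) 2 (rowM d) :=
      hψ.comp_measurePreserving (mp_dot hd (y i) (hy i))
    have m2 : ∀ l, MemLp (fun v => (hR l).eval (dotp v (y j))) 2 (rowM d) := fun l =>
      (memLp_poly (hR l)).comp_measurePreserving (mp_dot hd (y j) (hy j))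
    have hi : ∀ l, Integrable (fun v => ψ (dotp v (y i)) * (hR l).eval (dotp v (y j))) (rowM d) :=
      fun l => m1.integrable_mul (m2 l)
    have e : ∀ v, ψ (dotp v (y i)) * w (dotp v (y j)) =
        (a / Real.sqrt (Nat.factorial l)) * (ψ (dotp v (y i)) * (hR l).eval (dotp v (y j)))
        + (b / Real.sqrt (Nat.factorial l')) * (ψ (dotp v (y i)) * (hR l').eval (dotp v (y j))) := by
      intro v; rw [hw]; ring
    simp_rw [e]
    rw [integral_add ((hi _).const_mul _) ((hi _).const_mul _), integral_const_mul,
      integral_const_mul, E, E]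
    have c : ∀ l, ∫ g, ψ g * (hR l).eval g ∂gam = Real.sqrt (Nat.factorial l) * hermiteCoeff ψ l := by
      intro l
      have : Real.sqrt (Nat.factorial l) ≠ 0 := by positivity
      rw [hermiteCoeff, ← integral_const_mul]
      congr 1; funext g; rw [hermiteFn_eq]; field_simp
    rw [c, c, h1, h2, ker2]
    field_simp
  have wcoef : ∀ k, hermiteCoeff w k = (if k = l then a else 0) + (if k = l' then b else 0) := by
    intro k
    have hfk : Real.sqrt (Nat.factorial k) ≠ 0 := by positivity
    have hi : ∀ n, Integrable (fun g => (hR n).eval g * (hR k).eval g) gam := fun n => by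
      simpa using integrable_poly_gam (hR n * hR k)
    have e : ∀ g, w g * hermiteFn k g =
        (a / (Real.sqrt (Nat.factorial l) * Real.sqrt (Nat.factorial k))) * ((hR l).eval g * (hR k).eval g)
        + (b / (Real.sqrt (Nat.factorial l') * Real.sqrt (Nat.factorial k))) * ((hR l').eval g * (hR k).eval g) := by
      intro g; rw [hw, hermiteFn_eq]; field_simp
    rw [hermiteCoeff]
    simp_rw [e]
    rw [integral_add ((hi _).const_mul _) ((hi _).const_mul _), integral_const_mul,
      integral_const_mul, hR_orth, hR_orth]
    congr 1
    · by_cases hk : k = l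
      · subst hk; simp only [if_true]
        rw [Real.mul_self_sqrt (by positivity)]; field_simp
      · simp [hk, Ne.symm hk]
    · by_cases hk : k = l'
      · subst hk; simp only [if_true]
        rw [Real.mul_self_sqrt (by positivity)]; field_simp
      · simp [hk, Ne.symm hk]
  have cφ := cross φ hφ hφm ha.symm hb.symm
  have cw := cross w hwL hwm (by rw [wcoef]; simp [hl]) (by rw [wcoef]; simp [hl.symm])
  have mφ : ∀ i, MemLp (fun v => φ (dotp v (y i))) 2 (rowM d) := fun i =>
    hφ.comp_measurePreserving (mp_dot hd (y i) (hy i))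
  have mw : ∀ i, MemLp (fun v => w (dotp v (y i))) 2 (rowM d) := fun i =>
    hwL.comp_measurePreserving (mp_dot hd (y i) (hy i))
  have expand : ∀ ψ : ℝ → ℝ, (∀ i, MemLp (fun v => ψ (dotp v (y i))) 2 (rowM d)) →
      (∀ i j, ∫ v, ψ (dotp v (y i)) * w (dotp v (y j)) ∂(rowM d)
        = ker2 (a ^ 2) (b ^ 2) l l' (dotp (y i) (y j) / d)) →
      ∫ v, (∑ i, θ i * ψ (dotp v (y i))) * (∑ j, θ j * w (dotp v (y j))) ∂(rowM d)
      = ∑ i, ∑ j, θ i * θ j * ker2 (a ^ 2) (b ^ 2) l l' (dotp (y i) (y j) / d) := by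
    intro ψ hψ hc
    have e : ∀ v, (∑ i, θ i * ψ (dotp v (y i))) * (∑ j, θ j * w (dotp v (y j)))
        = ∑ i, ∑ j, θ i * θ j * (ψ (dotp v (y i)) * w (dotp v (y j))) := by
      intro v
      rw [Finset.sum_mul_sum]
      refine Finset.sum_congr rfl fun i _ => Finset.sum_congr rfl fun j _ => by ring
    have hi : ∀ i j, Integrable (fun v => θ i * θ j * (ψ (dotp v (y i)) * w (dotp v (y j)))) (rowM d) :=
      fun i j => ((hψ i).integrable_mul (mw j)).const_mul _
    simp_rw [e]
    rw [integral_finsetSum _ (fun i _ => integrable_finsetSum _ fun j _ => hi i j)]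
    refine Finset.sum_congr rfl fun i _ => ?_
    rw [integral_finsetSum _ (fun j _ => hi i j)]
    refine Finset.sum_congr rfl fun j _ => ?_
    rw [integral_const_mul, hc]
  have mf : MemLp (fun v => ∑ i, θ i * φ (dotp v (y i))) 2 (rowM d) :=
    memLp_finsetSum _ fun i _ => (mφ i).const_mul _
  have mg : MemLp (fun v => ∑ i, θ i * w (dotp v (y i))) 2 (rowM d) :=
    memLp_finsetSum _ fun i _ => (mw i).const_mul _
  have E1 := expand φ mφ cφ
  have E2 := expand w mw cw
  have i1 := mf.integrable_sq
  have i2 : Integrable (fun v => (∑ i, θ i * φ (dotp v (y i))) * (∑ j, θ j * w (dotp v (y j)))) (rowM d) :=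
    mf.integrable_mul mg
  have i3 : Integrable (fun v => (∑ i, θ i * w (dotp v (y i))) * (∑ j, θ j * w (dotp v (y j)))) (rowM d) :=
    mg.integrable_mul mg
  have i4 : Integrable (fun v => 2 * ((∑ i, θ i * φ (dotp v (y i))) * (∑ j, θ j * w (dotp v (y j))))
    - (∑ i, θ i * w (dotp v (y i))) * (∑ j, θ j * w (dotp v (y j)))) (rowM d) := (i2.const_mul 2).sub i3
  have := integral_mono i4 i1 (fun v => by
    simp only
    nlinarith [sq_nonneg ((∑ i, θ i * φ (dotp v (y i))) - (∑ j, θ j * w (dotp v (y j))))])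
  rw [integral_sub (i2.const_mul 2) i3, integral_const_mul, E1, E2] at this
  linarith

/-! ### Deterministic kernel bounds -/

lemma ker2_bound_aux {A B : ℝ} (hA : 0 < A) (hB : 0 < B) (i j : ℕ) {η' : ℝ} (hη : 0 < η') :
    ∃ δ : ℝ, 0 < δ ∧ δ ≤ 1 ∧ ∀ c : ℝ, -1 ≤ c → c ≤ 1 - η' →
      |ker2 A B (2*i+3) (2*j+4) c| ≤ (1 - δ) * (A + B) * |c| ^ 3 := by
  set m := min (B * η') (min A B) with hm
  have m1 : m ≤ B * η' := min_le_left _ _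
  have m2 : m ≤ A := (min_le_right _ _).trans (min_le_left _ _)
  have m3 : m ≤ B := (min_le_right _ _).trans (min_le_right _ _)
  have m0 : 0 < m := by positivity
  have hAB : 0 < A + B := by positivity
  refine ⟨m / (A + B), by positivity, ?_, ?_⟩
  · rw [div_le_one hAB]; linarith
  intro c h1 h2
  have e : (1 - m / (A + B)) * (A + B) = A + B - m := by field_simp
  rw [e]
  have e2 : ker2 A B (2*i+3) (2*j+4) c = (A * c ^ (2*i) + B * c ^ (2*j+1)) * c ^ 3 := by
    rw [ker2]; ring
  rw [e2, abs_mul, abs_pow]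
  refine mul_le_mul_of_nonneg_right ?_ (by positivity)
  rcases le_or_gt 0 c with hc | hc
  · have hc1 : c ≤ 1 := by linarith
    have p1 : c ^ (2*i) ≤ 1 := pow_le_one₀ hc hc1
    have p2 : c ^ (2*j+1) ≤ c := by
      rw [pow_succ]
      have : c ^ (2*j) ≤ 1 := pow_le_one₀ hc hc1
      nlinarith
    have p3 : 0 ≤ c ^ (2*i) := by positivity
    have p4 : 0 ≤ c ^ (2*j+1) := by positivity
    rw [abs_of_nonneg (by positivity)]
    nlinarith
  · obtain ⟨b, rfl⟩ : ∃ b, c = -b := ⟨-c, by ring⟩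
    have hb0 : 0 ≤ b := by linarith
    have hb1 : b ≤ 1 := by linarith
    have q1 : (-b) ^ (2*i) = b ^ (2*i) := Even.neg_pow (by simp) b
    have q2 : (-b) ^ (2*j+1) = - b ^ (2*j+1) := Odd.neg_pow ⟨j, rfl⟩ b
    rw [q1, q2]
    have p1 : b ^ (2*i) ≤ 1 := pow_le_one₀ hb0 hb1
    have p2 : b ^ (2*j+1) ≤ 1 := pow_le_one₀ hb0 hb1
    have p3 : 0 ≤ b ^ (2*i) := by positivity
    have p4 : 0 ≤ b ^ (2*j+1) := by positivity
    rw [abs_le]; constructor <;> nlinarith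

lemma ker2_swap (A B : ℝ) (l l' : ℕ) (c : ℝ) : ker2 A B l l' c = ker2 B A l' l c := by
  simp [ker2]; ring

lemma ker2_bound {A B : ℝ} (hA : 0 < A) (hB : 0 < B) {l l' : ℕ} (hl : 3 ≤ l) (hl' : 3 ≤ l')
    (hpar : l % 2 ≠ l' % 2) {η' : ℝ} (hη : 0 < η') :
    ∃ δ : ℝ, 0 < δ ∧ δ ≤ 1 ∧ ∀ c : ℝ, -1 ≤ c → c ≤ 1 - η' →
      |ker2 A B l l' c| ≤ (1 - δ) * (A + B) * |c| ^ 3 := by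
  rcases Nat.mod_two_eq_zero_or_one l with h | h
  · obtain ⟨j, rfl⟩ : ∃ j, l = 2*j+4 := ⟨(l-4)/2, by omega⟩
    obtain ⟨i, rfl⟩ : ∃ i, l' = 2*i+3 := ⟨(l'-3)/2, by omega⟩
    obtain ⟨δ, h1, h2, h3⟩ := ker2_bound_aux hB hA i j hη
    refine ⟨δ, h1, h2, fun c a b => ?_⟩
    rw [ker2_swap, add_comm A B]
    exact h3 c a b
  · obtain ⟨j, rfl⟩ : ∃ j, l' = 2*j+4 := ⟨(l'-4)/2, by omega⟩
    obtain ⟨i, rfl⟩ : ∃ i, l = 2*i+3 := ⟨(l-3)/2, by omega⟩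
    exact ker2_bound_aux hA hB i j hη

lemma ker2_cube {A B : ℝ} (hA : 0 < A) (hB : 0 < B) {l l' : ℕ} (hl : 3 ≤ l) (hl' : 3 ≤ l')
    {c τ : ℝ} (hc : |c| ≤ τ) (hτ : τ ≤ 1) :
    |ker2 A B l l' c| ≤ (A + B) * τ ^ 3 := by
  have h0 : 0 ≤ |c| := abs_nonneg c
  have key : ∀ l, 3 ≤ l → |c| ^ l ≤ τ ^ 3 := fun l hl =>
    (pow_le_pow_of_le_one h0 (hc.trans hτ) hl).trans (pow_le_pow_left₀ h0 hc 3)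
  have k1 := key l hl
  have k2 := key l' hl'
  calc |ker2 A B l l' c| ≤ |A * c ^ l| + |B * c ^ l'| := abs_add_le _ _
    _ = A * |c| ^ l + B * |c| ^ l' := by
      rw [abs_mul, abs_mul, abs_pow, abs_pow, abs_of_pos hA, abs_of_pos hB]
    _ ≤ _ := by nlinarith

lemma offdiag {n : ℕ} (M : Fin n → Fin n → ℝ) (m e : ℝ) (he : 0 ≤ e) (hd : ∀ i, M i i = m)
    (ho : ∀ i j, i ≠ j → |M i j| ≤ e) (a : Fin n → ℝ) :
    |∑ i, ∑ j, a i * a j * M i j - m * ∑ i, a i ^ 2| ≤ n * e * ∑ i, a i ^ 2 := by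
  have e1 : ∑ i, ∑ j, a i * a j * M i j - m * ∑ i, a i ^ 2
      = ∑ i, ∑ j, a i * a j * (M i j - if i = j then m else 0) := by
    simp_rw [mul_sub, Finset.sum_sub_distrib]
    congr 1
    rw [Finset.mul_sum]
    refine Finset.sum_congr rfl fun i _ => ?_
    simp; ring
  rw [e1]
  have hle : ∀ i j, |M i j - if i = j then m else 0| ≤ e := by
    intro i j
    by_cases h : i = j
    · subst h; simp [hd, he]
    · simpa [h] using ho i j h
  calc |∑ i, ∑ j, a i * a j * (M i j - if i = j then m else 0)|
      ≤ ∑ i, ∑ j, |a i| * |a j| * e := by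
        refine (Finset.abs_sum_le_sum_abs _ _).trans (Finset.sum_le_sum fun i _ => ?_)
        refine (Finset.abs_sum_le_sum_abs _ _).trans (Finset.sum_le_sum fun j _ => ?_)
        rw [abs_mul, abs_mul]
        exact mul_le_mul_of_nonneg_left (hle i j) (by positivity)
    _ = e * (∑ i, |a i|) ^ 2 := by
        rw [pow_two, Finset.sum_mul_sum, Finset.mul_sum]
        refine Finset.sum_congr rfl fun i _ => ?_
        rw [Finset.mul_sum]
        refine Finset.sum_congr rfl fun j _ => by ring
    _ ≤ e * (n * ∑ i, a i ^ 2) := by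
        refine mul_le_mul_of_nonneg_left ?_ he
        have := sq_sum_le_card_mul_sum_sq (s := Finset.univ) (f := fun i => |a i|)
        simpa using this
    _ = _ := by ring

lemma cube_psd {m d : ℕ} (y : Fin m → Fin d → ℝ) (θ : Fin m → ℝ) :
    0 ≤ ∑ i, ∑ j, θ i * θ j * (dotp (y i) (y j)) ^ 3 := by
  have : ∑ i, ∑ j, θ i * θ j * (dotp (y i) (y j)) ^ 3
      = ∑ a, ∑ b, ∑ c, (∑ i, θ i * (y i a * y i b * y i c)) ^ 2 := by
    have e : ∀ i j, θ i * θ j * (dotp (y i) (y j)) ^ 3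
        = ∑ a, ∑ b, ∑ c, (θ i * (y i a * y i b * y i c)) * (θ j * (y j a * y j b * y j c)) := by
      intro i j
      rw [pow_succ, pow_two, dotp, Finset.sum_mul_sum, Finset.sum_mul, Finset.mul_sum]
      refine Finset.sum_congr rfl fun a _ => ?_
      rw [Finset.sum_mul_sum, Finset.mul_sum]
      refine Finset.sum_congr rfl fun b _ => ?_
      rw [Finset.mul_sum]
      refine Finset.sum_congr rfl fun c _ => by ring
    simp_rw [e, pow_two, Finset.sum_mul_sum]
    have c1 : ∀ (F : Fin m → Fin d → Fin d → Fin d → ℝ),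
        ∑ j, ∑ a, ∑ b, ∑ c, F j a b c = ∑ a, ∑ b, ∑ c, ∑ j, F j a b c := by
      intro F
      rw [Finset.sum_comm]
      refine Finset.sum_congr rfl fun a _ => ?_
      rw [Finset.sum_comm]
      refine Finset.sum_congr rfl fun b _ => ?_
      rw [Finset.sum_comm]
    simp_rw [c1]
  rw [this]
  positivity

set_option maxHeartbeats 1000000 in
lemma quad_lower {n d : ℕ} (hd : 0 < d) (y : Fin (n+1) → Fin d → ℝ)
    (hy : ∀ i, dotp (y i) (y i) = d) {A B : ℝ} (hA : 0 < A) (hB : 0 < B) {l l' : ℕ} (hl : 3 ≤ l)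
    (hl' : 3 ≤ l') {δ τ : ℝ} (hδ : 0 < δ) (hδ1 : δ ≤ 1) (hτ0 : 0 ≤ τ) (hτ1 : τ ≤ 1)
    (hk : ∀ i : Fin n, |ker2 A B l l' (dotp (y 0) (y i.succ) / d)| ≤
      (1 - δ) * (A + B) * |dotp (y 0) (y i.succ) / d| ^ 3)
    (ho : ∀ i j : Fin n, i ≠ j → |dotp (y i.succ) (y j.succ) / d| ≤ τ)
    (hnτ : n * τ ^ 3 ≤ δ / 4) (θ : Fin (n+1) → ℝ) :
    (A + B) * (δ / 2) * ∑ i, θ i ^ 2 ≤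
      ∑ i, ∑ j, θ i * θ j * ker2 A B l l' (dotp (y i) (y j) / d) := by
  have hd' : (d : ℝ) ≠ 0 := by positivity
  have hsym : ∀ i j, dotp (y i) (y j) = dotp (y j) (y i) := by
    intro i j; simp [dotp, mul_comm]
  set γ := δ / 4 with hγ
  set b := θ 0 with hb
  set a : Fin n → ℝ := fun i => θ i.succ with ha
  set c : Fin n → ℝ := fun i => dotp (y 0) (y i.succ) / d with hc
  set R : Fin n → Fin n → ℝ := fun i j => dotp (y i.succ) (y j.succ) / d with hR
  set a2 := ∑ i, a i ^ 2 with ha2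
  have ha20 : 0 ≤ a2 := by positivity
  set κ := A + B with hκ
  have hκ0 : 0 < κ := by positivity
  have Rdiag : ∀ i, R i i = 1 := by intro i; simp [hR, hy, hd']
  -- sixth powers
  have S6 : ∑ i, c i ^ 6 ≤ 1 + γ := by
    set S := ∑ i, c i ^ 6 with hS
    have hS0 : 0 ≤ S := by positivity
    have h1 := offdiag (fun i j => (R i j) ^ 3) 1 (τ ^ 3) (by positivity)
      (by intro i; simp [Rdiag]) (by
        intro i j hij
        rw [abs_pow]
        exact pow_le_pow_left₀ (abs_nonneg _) (ho i j hij) 3) (fun i => c i ^ 3)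
    have e6 : ∑ i, (c i ^ 3) ^ 2 = S := by
      refine Finset.sum_congr rfl fun i _ => by ring
    rw [e6, abs_le] at h1
    have h2 := cube_psd y (Fin.cons (-S) (fun i => c i ^ 3) : Fin (n+1) → ℝ)
    rw [Fin.sum_univ_succ] at h2
    simp_rw [Fin.sum_univ_succ (n := n)] at h2
    simp only [Fin.cons_zero, Fin.cons_succ] at h2
    rw [Finset.sum_add_distrib] at h2
    have f1 : ∑ i, -S * c i ^ 3 * dotp (y 0) (y i.succ) ^ 3 = - S * S * d ^ 3 := by
      rw [hS, Finset.mul_sum, Finset.sum_mul]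
      refine Finset.sum_congr rfl fun i _ => ?_
      simp only [hc]; field_simp
    have f2 : ∑ i : Fin n, c i ^ 3 * -S * dotp (y i.succ) (y 0) ^ 3 = - S * S * d ^ 3 := by
      rw [← f1]
      refine Finset.sum_congr rfl fun i _ => ?_
      rw [hsym]; ring
    have f3 : ∑ i : Fin n, ∑ j : Fin n, c i ^ 3 * c j ^ 3 * dotp (y i.succ) (y j.succ) ^ 3
        = d ^ 3 * ∑ i, ∑ j, c i ^ 3 * c j ^ 3 * (R i j) ^ 3 := by
      rw [Finset.mul_sum]
      refine Finset.sum_congr rfl fun i _ => ?_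
      rw [Finset.mul_sum]
      refine Finset.sum_congr rfl fun j _ => ?_
      simp only [hR]; field_simp
    rw [f1, f2, f3, hy] at h2
    set Z := ∑ i, ∑ j, c i ^ 3 * c j ^ 3 * (R i j) ^ 3 with hZ
    have h3 : 0 ≤ (d:ℝ) ^ 3 * (Z - S * S) := by linarith
    have h4 : 0 ≤ Z - S * S := by
      by_contra hneg
      push Not at hneg
      have : (0:ℝ) < (d:ℝ)^3 := by positivity
      nlinarith
    have h5 : S * S ≤ (1 + γ) * S := by nlinarith [h1.2]
    by_contra hneg
    push Not at hneg
    nlinarith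
  -- cross term
  set W := ∑ i, |a i| * |c i| ^ 3 with hW
  have hW0 : 0 ≤ W := by positivity
  have hW2 : W ^ 2 ≤ (1 + γ) * a2 := by
    have := Finset.sum_mul_sq_le_sq_mul_sq Finset.univ (fun i => |a i|) (fun i => |c i| ^ 3)
    have e6 : ∑ i, (|c i| ^ 3) ^ 2 = ∑ i, c i ^ 6 := by
      refine Finset.sum_congr rfl fun i _ => ?_
      rw [← pow_mul]; norm_num
      rw [show (6:ℕ) = 2 * 3 by norm_num, pow_mul, sq_abs, pow_mul]
    rw [e6] at this
    simp only [sq_abs] at this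
    calc W ^ 2 ≤ a2 * ∑ i, c i ^ 6 := this
      _ ≤ a2 * (1 + γ) := mul_le_mul_of_nonneg_left S6 ha20
      _ = _ := by ring
  have hcross : |∑ i, a i * ker2 A B l l' (c i)| ≤ (1 - δ) * κ * W := by
    refine (Finset.abs_sum_le_sum_abs _ _).trans ?_
    rw [hW, Finset.mul_sum]
    refine Finset.sum_le_sum fun i _ => ?_
    rw [abs_mul]
    have := mul_le_mul_of_nonneg_left (hk i) (abs_nonneg (a i))
    linarith
  have k1 : ker2 A B l l' 1 = κ := by simp [ker2, hκ]
  have hoff := offdiag (fun i j => ker2 A B l l' (R i j)) κ (κ * τ ^ 3) (by positivity)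
    (by intro i; simp [Rdiag, k1]) (by
      intro i j hij
      exact ker2_cube hA hB hl hl' (ho i j hij) hτ1) a
  rw [abs_le] at hoff
  set X := ∑ i, a i * ker2 A B l l' (c i) with hX
  have expand : ∑ i, ∑ j, θ i * θ j * ker2 A B l l' (dotp (y i) (y j) / d)
      = b ^ 2 * κ + 2 * b * X + ∑ i, ∑ j, a i * a j * ker2 A B l l' (R i j) := by
    rw [Fin.sum_univ_succ]
    simp_rw [Fin.sum_univ_succ (n := n)]
    rw [Finset.sum_add_distrib]
    have g1 : ∑ i : Fin n, θ 0 * θ i.succ * ker2 A B l l' (dotp (y 0) (y i.succ) / d) = b * X := by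
      rw [hX, Finset.mul_sum]
      refine Finset.sum_congr rfl fun i _ => ?_
      simp only [ha, hb, hc]; ring
    have g2 : ∑ i : Fin n, θ i.succ * θ 0 * ker2 A B l l' (dotp (y i.succ) (y 0) / d) = b * X := by
      rw [← g1]
      refine Finset.sum_congr rfl fun i _ => ?_
      rw [hsym]; ring
    rw [g1, g2, hy, div_self hd', k1]
    simp only [ha, hb, hR]; ring
  rw [expand, Fin.sum_univ_succ]
  change κ * (δ / 2) * (b ^ 2 + a2) ≤ _
  have hγ0 : 0 < γ := by positivity
  have hbW : 2 * |b| * W ≤ (1 + γ) * (b ^ 2 + a2) := by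
    have h1 : 2 * |b| * W ≤ (1+γ) * b ^ 2 + W ^ 2 / (1 + γ) := by
      have h2 : 0 ≤ ((1+γ) * |b| - W) ^ 2 / (1 + γ) := by positivity
      have h3 : ((1+γ) * |b| - W) ^ 2 / (1 + γ) = (1+γ) * |b|^2 - 2 * |b| * W + W ^ 2 / (1 + γ) := by
        field_simp; ring
      rw [h3, sq_abs] at h2
      linarith
    have h4 : W ^ 2 / (1 + γ) ≤ a2 := by
      rw [div_le_iff₀ (by positivity)]; linarith
    nlinarith
  have hbX : -((1 - δ) * κ * ((1 + γ) * (b ^ 2 + a2))) ≤ 2 * b * X := by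
    have h1 : |2 * b * X| ≤ 2 * |b| * ((1 - δ) * κ * W) := by
      rw [abs_mul, abs_mul, abs_two]
      exact mul_le_mul_of_nonneg_left hcross (by positivity)
    have h2 : 2 * |b| * ((1 - δ) * κ * W) ≤ (1 - δ) * κ * ((1 + γ) * (b ^ 2 + a2)) := by
      have : 0 ≤ (1 - δ) * κ := mul_nonneg (by linarith) hκ0.le
      calc 2 * |b| * ((1 - δ) * κ * W) = (1 - δ) * κ * (2 * |b| * W) := by ring
        _ ≤ _ := mul_le_mul_of_nonneg_left hbW this
    have := (abs_le.1 (h1.trans h2)).1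
    linarith
  have hQ : κ * a2 - κ * γ * a2 ≤ ∑ i, ∑ j, a i * a j * ker2 A B l l' (R i j) := by
    have : (n:ℝ) * (κ * τ ^ 3) * a2 ≤ κ * γ * a2 := by
      refine mul_le_mul_of_nonneg_right ?_ ha20
      nlinarith
    linarith [hoff.1]
  have hs : 0 ≤ b ^ 2 + a2 := by positivity
  have final : κ * (δ / 2) * (b ^ 2 + a2) ≤ b ^ 2 * κ - (1 - δ) * κ * ((1 + γ) * (b ^ 2 + a2)) + (κ * a2 - κ * γ * a2) := by
    have e : b ^ 2 * κ - (1 - δ) * κ * ((1 + γ) * (b ^ 2 + a2)) + (κ * a2 - κ * γ * a2)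
        = κ * (1 - (1 - δ) * (1 + γ) - γ) * (b ^ 2 + a2) + κ * γ * b ^ 2 := by ring
    rw [e]
    have h1 : δ / 2 ≤ 1 - (1 - δ) * (1 + γ) - γ := by rw [hγ]; nlinarith
    have h2 : κ * (δ / 2) * (b ^ 2 + a2) ≤ κ * (1 - (1 - δ) * (1 + γ) - γ) * (b ^ 2 + a2) :=
      mul_le_mul_of_nonneg_right (mul_le_mul_of_nonneg_left h1 hκ0.le) hs
    have h3 : 0 ≤ κ * γ * b ^ 2 := by positivity
    linarith
  linarith

/-! ### Small ball estimate -/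

lemma exists_exp_sq {φ : ℝ → ℝ} (hφ : Continuous φ) {Λ : ℝ} (hΛ : 0 < Λ)
    (hb : ∀ t, |φ t| ≤ Λ * (1 + |t|)) :
    ∃ lam : ℝ, 0 < lam ∧ Integrable (fun g => Real.exp (lam * φ g ^ 2)) gam := by
  obtain ⟨C, hC, hi⟩ := IsGaussian.exists_integrable_exp_sq gam
  refine ⟨C / (2 * Λ ^ 2), by positivity, ?_⟩
  refine (hi.const_mul (Real.exp C)).mono' (by fun_prop) (ae_of_all _ fun g => ?_)
  rw [Real.norm_eq_abs, abs_of_pos (Real.exp_pos _), ← Real.exp_add]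
  apply Real.exp_le_exp.2
  have h1 : φ g ^ 2 ≤ Λ ^ 2 * (2 * (1 + g ^ 2)) := by
    have h2 : φ g ^ 2 ≤ (Λ * (1 + |g|)) ^ 2 := by
      rw [← sq_abs]; exact pow_le_pow_left₀ (abs_nonneg _) (hb g) 2
    have h3 : (1 + |g|) ^ 2 ≤ 2 * (1 + g ^ 2) := by
      have := sq_abs g
      nlinarith [sq_nonneg (1 - |g|)]
    calc φ g ^ 2 ≤ Λ ^ 2 * (1 + |g|) ^ 2 := by rw [← mul_pow]; exact h2
      _ ≤ _ := mul_le_mul_of_nonneg_left h3 (by positivity)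
  calc C / (2 * Λ ^ 2) * φ g ^ 2 ≤ C / (2 * Λ ^ 2) * (Λ ^ 2 * (2 * (1 + g ^ 2))) :=
        mul_le_mul_of_nonneg_left h1 (by positivity)
    _ = C + C * ‖g‖ ^ 2 := by rw [Real.norm_eq_abs, sq_abs]; field_simp

lemma small_ball {φ : ℝ → ℝ} (hφ : Continuous φ) (hφL : MemLp φ 2 gam) {lam : ℝ} (hlam : 0 < lam)
    (hi : Integrable (fun g => Real.exp (lam * φ g ^ 2)) gam)
    {d m : ℕ} (hd : 0 < d) (y : Fin m → Fin d → ℝ) (hy : ∀ i, dotp (y i) (y i) = d)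
    (θ : Fin m → ℝ) (hθ : ∑ i, θ i ^ 2 = 1) {δ₀ s : ℝ} (hδ : 0 < δ₀) (hs : 0 ≤ s)
    (hE : δ₀ ≤ ∫ v, (∑ i, θ i * φ (dotp v (y i))) ^ 2 ∂(rowM d)) :
    δ₀ / 2 - m * (Real.exp (-(lam * s)) / lam * ∫ g, Real.exp (lam * φ g ^ 2) ∂gam) ≤
      m * s * (rowM d).real {v | δ₀ / 2 ≤ (∑ i, θ i * φ (dotp v (y i))) ^ 2} := by
  set S := {v : Fin d → ℝ | δ₀ / 2 ≤ (∑ i, θ i * φ (dotp v (y i))) ^ 2} with hS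
  have hcd : ∀ i, Continuous (fun v : Fin d → ℝ => φ (dotp v (y i))) := by
    intro i; apply hφ.comp; unfold dotp; fun_prop
  have hcf : Continuous (fun v : Fin d → ℝ => (∑ i, θ i * φ (dotp v (y i))) ^ 2) :=
    (continuous_finsetSum _ fun i _ => continuous_const.mul (hcd i)).pow 2
  have hSm : MeasurableSet S := measurableSet_le measurable_const hcf.measurable
  have hpt : ∀ v, (∑ i, θ i * φ (dotp v (y i))) ^ 2 ≤ δ₀ / 2 + (m * s) * S.indicator 1 v
      + ∑ i, Real.exp (-(lam * s)) / lam * Real.exp (lam * φ (dotp v (y i)) ^ 2) := by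
    intro v
    have hpos : 0 ≤ ∑ i, Real.exp (-(lam * s)) / lam * Real.exp (lam * φ (dotp v (y i)) ^ 2) := by
      positivity
    by_cases hv : v ∈ S
    · have h1 : (∑ i, θ i * φ (dotp v (y i))) ^ 2 ≤ ∑ i, φ (dotp v (y i)) ^ 2 := by
        have := Finset.sum_mul_sq_le_sq_mul_sq Finset.univ θ (fun i => φ (dotp v (y i)))
        rwa [hθ, one_mul] at this
      have h2 : ∑ i, φ (dotp v (y i)) ^ 2 ≤ ∑ i, (s + Real.exp (-(lam * s)) / lam *
          Real.exp (lam * φ (dotp v (y i)) ^ 2)) := by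
        refine Finset.sum_le_sum fun i _ => ?_
        set X := φ (dotp v (y i)) ^ 2
        have h3 : lam * (X - s) ≤ Real.exp (lam * (X - s)) := by
          linarith [Real.add_one_le_exp (lam * (X - s))]
        have h4 : Real.exp (-(lam * s)) / lam * Real.exp (lam * X) = Real.exp (lam * (X - s)) / lam := by
          rw [div_mul_eq_mul_div, ← Real.exp_add]; ring_nf
        rw [h4]
        have : X - s ≤ Real.exp (lam * (X - s)) / lam := by
          rw [le_div_iff₀ hlam]; linarith
        linarith
      rw [Finset.sum_add_distrib] at h2
      simp only [Finset.sum_const, Finset.card_univ, Fintype.card_fin, nsmul_eq_mul] at h2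
      simp only [Set.indicator_of_mem hv, Pi.one_apply, mul_one]
      linarith
    · simp only [Set.indicator_of_notMem hv, mul_zero]
      have : (∑ i, θ i * φ (dotp v (y i))) ^ 2 < δ₀ / 2 := by simpa [S] using hv
      linarith
  have mφ : ∀ i, MemLp (fun v => φ (dotp v (y i))) 2 (rowM d) := fun i =>
    hφL.comp_measurePreserving (mp_dot hd (y i) (hy i))
  have i1 : Integrable (fun v => (∑ i, θ i * φ (dotp v (y i))) ^ 2) (rowM d) :=
    (memLp_finsetSum _ fun i _ => (mφ i).const_mul _).integrable_sq
  have i2 : ∀ i, Integrable (fun v => Real.exp (lam * φ (dotp v (y i)) ^ 2)) (rowM d) := fun i =>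
    (mp_dot hd (y i) (hy i)).integrable_comp_of_integrable hi
  have i3 : Integrable (fun v => δ₀ / 2 + (m * s) * S.indicator (1 : (Fin d → ℝ) → ℝ) v) (rowM d) :=
    (integrable_const _).add (((integrable_const _).indicator hSm).const_mul _)
  have i4 : Integrable (fun v => ∑ i, Real.exp (-(lam * s)) / lam *
      Real.exp (lam * φ (dotp v (y i)) ^ 2)) (rowM d) :=
    integrable_finsetSum _ fun i _ => (i2 i).const_mul _
  have hmono := integral_mono i1 (i3.add i4) hpt
  have e1 : ∫ v, ((fun v => δ₀ / 2 + (m * s) * S.indicator (1 : (Fin d → ℝ) → ℝ) v) + (fun v => ∑ i, Real.exp (-(lam * s)) / lam *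
      Real.exp (lam * φ (dotp v (y i)) ^ 2))) v ∂(rowM d)
      = δ₀ / 2 + m * s * (rowM d).real S + m * (Real.exp (-(lam * s)) / lam * ∫ g, Real.exp (lam * φ g ^ 2) ∂gam) := by
    rw [integral_add' i3 i4, integral_finsetSum _ (fun i _ => (i2 i).const_mul _)]
    congr 1
    · rw [integral_add (integrable_const _) (((integrable_const _).indicator hSm).const_mul _),
        integral_const_mul, integral_indicator_one hSm]
      simp
    · have : ∀ i, ∫ v, Real.exp (-(lam * s)) / lam * Real.exp (lam * φ (dotp v (y i)) ^ 2) ∂(rowM d)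
          = Real.exp (-(lam * s)) / lam * ∫ g, Real.exp (lam * φ g ^ 2) ∂gam := by
        intro i
        rw [integral_const_mul]
        congr 1
        have hmp := mp_dot hd (y i) (hy i)
        rw [← hmp.map_eq, integral_map hmp.measurable.aemeasurable]
        exact (by fun_prop : Continuous fun g => Real.exp (lam * φ g ^ 2)).aestronglyMeasurable
      simp_rw [this]
      simp
  rw [e1] at hmono
  linarith

lemma box_prob {d : ℕ} (hd : 0 < d) {R : ℝ} (hR : 0 < R) :
    (rowM d).real {v | ∀ j, |v j| ≤ R}ᶜ ≤ 1 / R ^ 2 := by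
  have hd' : (d : ℝ) ≠ 0 := by positivity
  have hj : ∀ j : Fin d, Integrable (fun v : Fin d → ℝ => v j ^ 2) (rowM d) ∧
      ∫ v, v j ^ 2 ∂(rowM d) = (d:ℝ)⁻¹ := by
    intro j
    have hmp : MeasurePreserving (Function.eval j) (rowM d) (gaussianReal 0 ((d : NNReal))⁻¹) :=
      measurePreserving_eval _ j
    have hm := (memLp_id_gaussianReal (μ := 0) (v := (d:NNReal)⁻¹) 2)
    have hi : Integrable (fun x : ℝ => x ^ 2) (gaussianReal 0 ((d : NNReal))⁻¹) := hm.integrable_sq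
    refine ⟨hmp.integrable_comp_of_integrable hi, ?_⟩
    have e1 : ∫ v, v j ^ 2 ∂(rowM d) = ∫ x, x ^ 2 ∂(gaussianReal 0 ((d : NNReal))⁻¹) := by
      rw [← hmp.map_eq, integral_map hmp.measurable.aemeasurable]
      exact (by fun_prop : Continuous fun x : ℝ => x ^ 2).aestronglyMeasurable
    rw [e1]
    have := variance_id_gaussianReal (μ := 0) (v := (d:NNReal)⁻¹)
    rw [variance_of_integral_eq_zero (by fun_prop) (by simpa using integral_id_gaussianReal)] at this
    simpa using this
  have hIntg : Integrable (fun v : Fin d → ℝ => ∑ j, v j ^ 2) (rowM d) :=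
    integrable_finsetSum _ fun j _ => (hj j).1
  have hval : ∫ v, ∑ j, v j ^ 2 ∂(rowM d) = 1 := by
    rw [integral_finsetSum _ fun j _ => (hj j).1]
    simp_rw [fun j => (hj j).2]
    simp [hd']
  have hM := mul_meas_ge_le_integral_of_nonneg (μ := rowM d) (f := fun v : Fin d → ℝ => ∑ j, v j ^ 2)
    (ae_of_all _ fun v => by positivity) hIntg (R ^ 2)
  rw [hval] at hM
  have hsub : {v : Fin d → ℝ | ∀ j, |v j| ≤ R}ᶜ ⊆ {v | R ^ 2 ≤ ∑ j, v j ^ 2} := by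
    intro v hv
    simp only [Set.mem_compl_iff, Set.mem_ofPred_eq, not_forall, not_le] at hv
    obtain ⟨j, hj⟩ := hv
    have h1 : R ^ 2 ≤ v j ^ 2 := by
      rw [← sq_abs (v j)]; exact pow_le_pow_left₀ hR.le hj.le 2
    exact h1.trans (Finset.single_le_sum (f := fun j => v j ^ 2) (fun i _ => sq_nonneg _) (Finset.mem_univ j))
  have h2 := measureReal_mono (μ := rowM d) hsub
  rw [le_div_iff₀ (by positivity)]
  nlinarith [sq_nonneg R]

/-! ### Net argument -/

lemma net_bound {ι Y : Type*} [Fintype ι] [DecidableEq ι] [MeasurableSpace Y] (ν : Measure Y)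
    [IsProbabilityMeasure ν] (p N : ℕ) (ε M : ℝ) (hε : 0 < ε) (hM : M ≤ N * ε)
    (𝒦 : Set (ι → ℝ)) (h𝒦 : ∀ z ∈ 𝒦, ∀ i, |z i| ≤ M)
    (E Zr : (ι → ℝ) → Set Y) (Q : ENNReal) (hQ : ∀ z ∈ 𝒦, ν (E z)ᶜ ≤ Q)
    (hsep : ∀ z ∈ 𝒦, ∀ z' ∈ 𝒦, (∀ i, |z i - z' i| ≤ ε) → ∀ v ∈ Zr z, v ∉ E z') :
    (Measure.pi fun _ : Fin p => ν) {V | ∃ z ∈ 𝒦, ∀ k, V k ∈ Zr z} ≤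
      ((2 * N + 1 : ℕ) : ENNReal) ^ (Fintype.card ι) * Q ^ p := by
  classical
  let key : (ι → ℝ) → (ι → ℤ) := fun z i => ⌊z i / ε⌋
  let cells : Finset (ι → ℤ) := Fintype.piFinset fun _ => Finset.Icc (-(N:ℤ)) N
  have hcard : cells.card = (2 * N + 1) ^ (Fintype.card ι) := by
    simp only [cells, Fintype.card_piFinset, Int.card_Icc, Finset.prod_const, Finset.card_univ]
    congr 1
    omega
  let Bc : (ι → ℤ) → Set (Fin p → Y) := fun c =>
    if h : ∃ z ∈ 𝒦, key z = c then Set.pi Set.univ (fun _ => (E h.choose)ᶜ) else ∅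
  have hBc : ∀ c, (Measure.pi fun _ : Fin p => ν) (Bc c) ≤ Q ^ p := by
    intro c
    by_cases h : ∃ z ∈ 𝒦, key z = c
    · simp only [Bc, h, dif_pos]
      rw [Measure.pi_pi]
      simp only [Finset.prod_const, Finset.card_univ, Fintype.card_fin]
      exact pow_le_pow_left' (hQ _ h.choose_spec.1) p
    · simp [Bc, h]
  have hsub : {V : Fin p → Y | ∃ z ∈ 𝒦, ∀ k, V k ∈ Zr z} ⊆ ⋃ c ∈ cells, Bc c := by
    rintro V ⟨z, hz, hV⟩
    have hmem : key z ∈ cells := by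
      simp only [cells, Fintype.mem_piFinset, Finset.mem_Icc, key]
      intro i
      have h1 := abs_le.1 ((h𝒦 z hz i).trans hM)
      constructor
      · rw [Int.le_floor, le_div_iff₀ hε]; push_cast; linarith
      · have : (⌊z i / ε⌋ : ℝ) ≤ N := (Int.floor_le _).trans ((div_le_iff₀ hε).2 h1.2)
        exact_mod_cast this
    have h : ∃ z' ∈ 𝒦, key z' = key z := ⟨z, hz, rfl⟩
    simp only [Set.mem_iUnion]
    refine ⟨key z, hmem, ?_⟩
    simp only [Bc, h, dif_pos, Set.mem_pi, Set.mem_univ, forall_true_left]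
    intro k
    have hs := h.choose_spec
    refine hsep z hz h.choose hs.1 (fun i => ?_) _ (hV k)
    have hf : ⌊h.choose i / ε⌋ = ⌊z i / ε⌋ := congrFun hs.2 i
    have := Int.abs_sub_lt_one_of_floor_eq_floor hf.symm
    rw [← sub_div, abs_div, abs_of_pos hε, div_lt_one hε] at this
    exact this.le
  calc (Measure.pi fun _ : Fin p => ν) {V | ∃ z ∈ 𝒦, ∀ k, V k ∈ Zr z}
      ≤ (Measure.pi fun _ : Fin p => ν) (⋃ c ∈ cells, Bc c) := measure_mono hsub
    _ ≤ ∑ c ∈ cells, (Measure.pi fun _ : Fin p => ν) (Bc c) := measure_biUnion_finset_le _ _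
    _ ≤ ∑ c ∈ cells, Q ^ p := Finset.sum_le_sum fun c _ => hBc c
    _ = _ := by rw [Finset.sum_const, hcard]; simp

/-! ### Fixed data: bad event for the features -/

lemma dotp_cs {d : ℕ} (u v : Fin d → ℝ) : dotp u v ^ 2 ≤ dotp u u * dotp v v := by
  have := Finset.sum_mul_sq_le_sq_mul_sq Finset.univ u v
  simpa [dotp, sq] using this

lemma eNorm_sq {d : ℕ} (u : Fin d → ℝ) : eNorm u ^ 2 = dotp u u := by
  unfold eNorm dotp
  rw [Real.sq_sqrt (by positivity)]
  simp [sq]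

lemma eNorm_nonneg {d : ℕ} (u : Fin d → ℝ) : 0 ≤ eNorm u := Real.sqrt_nonneg _

lemma eNorm_eq_iff {d : ℕ} (u : Fin d → ℝ) : eNorm u = Real.sqrt d ↔ dotp u u = d := by
  rw [← eNorm_sq]
  constructor
  · intro h; rw [h, Real.sq_sqrt (by positivity)]
  · intro h; rw [← h, Real.sqrt_sq (eNorm_nonneg u)]

lemma dotp_sub_sub {d : ℕ} (u v : Fin d → ℝ) :
    dotp (u - v) (u - v) = dotp u u + dotp v v - 2 * dotp u v := by
  simp only [dotp, Finset.mul_sum, ← Finset.sum_add_distrib, ← Finset.sum_sub_distrib, Pi.sub_apply]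
  exact Finset.sum_congr rfl fun i _ => by ring

def comb (φ : ℝ → ℝ) {d n : ℕ} (X : Fin n → Fin d → ℝ) (xh : Fin d → ℝ) (θ : Fin (n + 1) → ℝ)
    (v : Fin d → ℝ) : ℝ :=
  ∑ i, θ i * φ (dotp v ((Fin.cons xh X : Fin (n + 1) → Fin d → ℝ) i))

lemma comb_diff {φ : ℝ → ℝ} {Λ : ℝ} (hΛ : 0 < Λ) (hb : ∀ t, |φ t| ≤ Λ * (1 + |t|))
    (hL : ∀ s t, |φ s - φ t| ≤ Λ * |s - t|) {d n : ℕ} (X : Fin n → Fin d → ℝ)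
    (hX : ∀ i, dotp (X i) (X i) = d) {xh xh' : Fin d → ℝ} {θ θ' : Fin (n + 1) → ℝ}
    (hx' : dotp xh' xh' = d) (hθ : ∑ i, θ i ^ 2 = 1)
    {ε : ℝ} (hε : 0 ≤ ε) (h1 : ∀ j, |xh j - xh' j| ≤ ε) (h2 : ∀ i, |θ i - θ' i| ≤ ε)
    (v : Fin d → ℝ) (hv : ∀ j, |v j| ≤ d) :
    |comb φ X xh θ v - comb φ X xh' θ' v| ≤ ε * (Λ * ((n + 1) * (1 + (d:ℝ) ^ 2) + (d:ℝ) ^ 2)) := by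
  have hvv : dotp v v ≤ (d:ℝ) ^ 3 := by
    calc dotp v v ≤ ∑ j : Fin d, (d:ℝ) ^ 2 := Finset.sum_le_sum fun j _ => by
          have := pow_le_pow_left₀ (abs_nonneg _) (hv j) 2
          rw [sq_abs] at this; linarith [sq (v j)]
      _ = _ := by simp; ring
  have hvy : ∀ y : Fin d → ℝ, dotp y y = d → |dotp v y| ≤ (d:ℝ) ^ 2 := by
    intro y hy
    apply abs_le_of_sq_le_sq _ (by positivity)
    calc dotp v y ^ 2 ≤ dotp v v * dotp y y := dotp_cs _ _
      _ ≤ (d:ℝ) ^ 3 * d := by rw [hy]; gcongr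
      _ = _ := by ring
  have hθ0 : |θ 0| ≤ 1 := by
    apply abs_le_of_sq_le_sq _ zero_le_one
    rw [one_pow, ← hθ]
    exact Finset.single_le_sum (f := fun j => θ j ^ 2) (fun i _ => sq_nonneg _) (Finset.mem_univ 0)
  have hd0 : |dotp v xh - dotp v xh'| ≤ (d:ℝ) ^ 2 * ε := by
    unfold dotp
    rw [← Finset.sum_sub_distrib]
    calc |∑ j, (v j * xh j - v j * xh' j)| ≤ ∑ j, |v j * xh j - v j * xh' j| :=
          Finset.abs_sum_le_sum_abs _ _
      _ ≤ ∑ j : Fin d, (d:ℝ) * ε := Finset.sum_le_sum fun j _ => by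
          rw [← mul_sub, abs_mul]; exact mul_le_mul (hv j) (h1 j) (abs_nonneg _) (by positivity)
      _ = _ := by simp; ring
  have hcomb : comb φ X xh θ v - comb φ X xh' θ' v =
      (∑ i, (θ i - θ' i) * φ (dotp v ((Fin.cons xh' X : Fin (n + 1) → Fin d → ℝ) i)))
        + θ 0 * (φ (dotp v xh) - φ (dotp v xh')) := by
    unfold comb
    simp only [Fin.sum_univ_succ, Fin.cons_zero, Fin.cons_succ, sub_mul, Finset.sum_sub_distrib]
    ring
  rw [hcomb]
  have a1 : |∑ i, (θ i - θ' i) * φ (dotp v ((Fin.cons xh' X : Fin (n + 1) → Fin d → ℝ) i))|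
      ≤ (n + 1) * (ε * (Λ * (1 + (d:ℝ) ^ 2))) := by
    calc _ ≤ ∑ i, |(θ i - θ' i) * φ (dotp v ((Fin.cons xh' X : Fin (n + 1) → Fin d → ℝ) i))| :=
          Finset.abs_sum_le_sum_abs _ _
      _ ≤ ∑ i : Fin (n + 1), (ε * (Λ * (1 + (d:ℝ) ^ 2))) := Finset.sum_le_sum fun i _ => by
          rw [abs_mul]
          refine mul_le_mul (h2 i) ?_ (abs_nonneg _) hε
          refine (hb _).trans ?_
          gcongr
          refine hvy _ ?_
          refine Fin.cases ?_ ?_ i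
          · simpa using hx'
          · intro i; simpa using hX i
      _ = _ := by simp
  have a2 : |θ 0 * (φ (dotp v xh) - φ (dotp v xh'))| ≤ Λ * ((d:ℝ) ^ 2 * ε) := by
    rw [abs_mul]
    calc _ ≤ 1 * (Λ * |dotp v xh - dotp v xh'|) :=
          mul_le_mul hθ0 (hL _ _) (abs_nonneg _) zero_le_one
      _ ≤ _ := by rw [one_mul]; gcongr
  calc _ ≤ _ := abs_add_le _ _
    _ ≤ _ := add_le_add a1 a2
    _ = _ := by ring

lemma comb_cont {φ : ℝ → ℝ} (hφ : Continuous φ) {d n : ℕ} (X : Fin n → Fin d → ℝ) (xh : Fin d → ℝ)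
    (θ : Fin (n + 1) → ℝ) : Continuous (comb φ X xh θ) := by
  unfold comb
  refine continuous_finsetSum _ fun i _ => continuous_const.mul (hφ.comp ?_)
  unfold dotp; fun_prop

/-- Constraint set for the reconstruction candidates and the coefficients. -/
def Kset {d n : ℕ} (η : ℝ) (X : Fin n → Fin d → ℝ) : Set ((Fin d → ℝ) × (Fin (n + 1) → ℝ)) :=
  {z | dotp z.1 z.1 = d ∧ ∑ i, z.2 i ^ 2 = 1 ∧ ∀ i, η ^ 2 * d ≤ dotp (z.1 - X i) (z.1 - X i)}

def Xgood {d n : ℕ} (τ : ℝ) (X : Fin n → Fin d → ℝ) : Prop :=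
  (∀ i, dotp (X i) (X i) = d) ∧ ∀ i j, i ≠ j → |dotp (X i) (X j)| ≤ τ * d

lemma comb_second_moment {φ : ℝ → ℝ} (hφ : Continuous φ) (hφL : MemLp φ 2 gam) {l l' : ℕ}
    (hl : 3 ≤ l) (hl' : 3 ≤ l') (hne : l ≠ l') (hμ : hermiteCoeff φ l ≠ 0)
    (hμ' : hermiteCoeff φ l' ≠ 0) {η δ τ : ℝ} (hδ : 0 < δ) (hδ1 : δ ≤ 1)
    (hk : ∀ c : ℝ, -1 ≤ c → c ≤ 1 - η ^ 2 / 2 →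
      |ker2 (hermiteCoeff φ l ^ 2) (hermiteCoeff φ l' ^ 2) l l' c| ≤
        (1 - δ) * (hermiteCoeff φ l ^ 2 + hermiteCoeff φ l' ^ 2) * |c| ^ 3)
    (hτ0 : 0 ≤ τ) (hτ1 : τ ≤ 1) {d n : ℕ} (hd : 0 < d) (hnτ : (n:ℝ) * τ ^ 3 ≤ δ / 4)
    (X : Fin n → Fin d → ℝ) (hX : Xgood τ X) (z : (Fin d → ℝ) × (Fin (n + 1) → ℝ))
    (hz : z ∈ Kset η X) :
    (hermiteCoeff φ l ^ 2 + hermiteCoeff φ l' ^ 2) * (δ / 2) ≤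
      ∫ v, comb φ X z.1 z.2 v ^ 2 ∂(rowM d) := by
  obtain ⟨z1, z2, z3⟩ := hz
  have hd' : (0:ℝ) < d := by positivity
  have hy : ∀ i, dotp ((Fin.cons z.1 X : Fin (n + 1) → Fin d → ℝ) i)
      ((Fin.cons z.1 X : Fin (n + 1) → Fin d → ℝ) i) = d := by
    intro i
    refine Fin.cases ?_ ?_ i
    · simpa using z1
    · intro i; simpa using hX.1 i
  have h1 := kernel_lower (l := l) (l' := l') hφL hφ.measurable hne hd _ hy z.2
  refine le_trans ?_ h1
  refine le_trans ?_ (quad_lower hd _ hy (by positivity) (by positivity) hl hl' hδ hδ1 hτ0 hτ1 ?_ ?_ hnτ z.2)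
  · rw [z2, mul_one]
  · intro i
    simp only [Fin.cons_zero, Fin.cons_succ]
    apply hk
    · rw [le_div_iff₀ hd']
      have := dotp_cs z.1 (X i)
      rw [z1, hX.1 i] at this
      have := abs_le_of_sq_le_sq (by linarith : dotp z.1 (X i) ^ 2 ≤ (d:ℝ) ^ 2) hd'.le
      linarith [(abs_le.1 this).1]
    · rw [div_le_iff₀ hd']
      have := z3 i
      rw [dotp_sub_sub, z1, hX.1 i] at this
      linarith
  · intro i j hij
    simp only [Fin.cons_succ]
    rw [abs_div, abs_of_pos hd', div_le_iff₀ hd']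
    exact hX.2 i j hij

lemma V_bound {φ : ℝ → ℝ} (hφ : Continuous φ) (hφL : MemLp φ 2 gam) {Λ : ℝ} (hΛ : 0 < Λ)
    (hb : ∀ t, |φ t| ≤ Λ * (1 + |t|))
    (hL : ∀ s t, |φ s - φ t| ≤ Λ * |s - t|) {lam : ℝ} (hlam : 0 < lam)
    (hi : Integrable (fun g => Real.exp (lam * φ g ^ 2)) gam) {η δ₀ s q : ℝ}
    (hδ : 0 < δ₀) (hs : 0 < s) {d n : ℕ} (hd : 0 < d) (X : Fin n → Fin d → ℝ)
    (hX : ∀ i, dotp (X i) (X i) = d)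
    (hE : ∀ z ∈ Kset η X, δ₀ ≤ ∫ v, comb φ X z.1 z.2 v ^ 2 ∂(rowM d))
    (hsmall : (1 / (d:ℝ) ^ 5 * (Λ * ((n + 1) * (1 + (d:ℝ) ^ 2) + (d:ℝ) ^ 2))) ^ 2 < δ₀ / 2)
    (hq : ((n:ℝ) + 1) * s * (q + 1 / (d:ℝ) ^ 2) ≤ δ₀ / 2 -
      (n + 1) * (Real.exp (-(lam * s)) / lam * ∫ g, Real.exp (lam * φ g ^ 2) ∂gam)) (p : ℕ) :
    gaussianMatrix p d {V | ∃ z ∈ Kset η X, ∀ k, comb φ X z.1 z.2 (V k) = 0} ≤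
      ((2 * d ^ 6 + 1 : ℕ) : ENNReal) ^ (d + n + 1) * ENNReal.ofReal (1 - q) ^ p := by
  have hd' : (0:ℝ) < d := by positivity
  have hd1 : (1:ℝ) ≤ d := by exact_mod_cast hd
  let pr : (Fin d ⊕ Fin (n + 1) → ℝ) → (Fin d → ℝ) × (Fin (n + 1) → ℝ) :=
    fun w => (fun j => w (Sum.inl j), fun i => w (Sum.inr i))
  have key := net_bound (rowM d) p (d ^ 6) (1 / (d:ℝ) ^ 5) d (by positivity)
    (by push_cast; rw [mul_one_div, le_div_iff₀ (by positivity)]; apply le_of_eq; ring)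
    {w | pr w ∈ Kset η X} ?_
    (fun w => {v | δ₀ / 2 ≤ comb φ X (pr w).1 (pr w).2 v ^ 2} ∩ {v | ∀ j, |v j| ≤ d})
    (fun w => {v | comb φ X (pr w).1 (pr w).2 v = 0}) (ENNReal.ofReal (1 - q)) ?_ ?_
  · have hc : Fintype.card (Fin d ⊕ Fin (n + 1)) = d + n + 1 := by simp [add_assoc]
    rw [hc] at key
    refine le_trans (measure_mono ?_) key
    rintro V ⟨z, hz, hV⟩
    exact ⟨Sum.elim z.1 z.2, hz, hV⟩
  · rintro w ⟨w1, w2, w3⟩ i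
    cases i with
    | inl j =>
      apply abs_le_of_sq_le_sq _ hd'.le
      calc w (Sum.inl j) ^ 2 ≤ dotp (pr w).1 (pr w).1 := by
            unfold dotp
            simp only [← sq]
            exact Finset.single_le_sum (f := fun j => w (Sum.inl j) ^ 2) (fun i _ => sq_nonneg _) (Finset.mem_univ j)
        _ = d := w1
        _ ≤ (d:ℝ) ^ 2 := by nlinarith
    | inr i =>
      refine le_trans ?_ hd1
      apply abs_le_of_sq_le_sq _ zero_le_one
      rw [one_pow, ← w2]
      exact Finset.single_le_sum (f := fun j => w (Sum.inr j) ^ 2) (fun i _ => sq_nonneg _) (Finset.mem_univ i)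
  · intro w hw
    have hy : ∀ i, dotp ((Fin.cons (pr w).1 X : Fin (n + 1) → Fin d → ℝ) i)
        ((Fin.cons (pr w).1 X : Fin (n + 1) → Fin d → ℝ) i) = d := by
      intro i
      refine Fin.cases ?_ ?_ i
      · simpa using hw.1
      · intro i; simpa using hX i
    have sb := small_ball hφ hφL hlam hi hd _ hy (pr w).2 hw.2.1 hδ hs.le (hE _ hw)
    have bp := box_prob hd hd'
    set S1 := {v | δ₀ / 2 ≤ comb φ X (pr w).1 (pr w).2 v ^ 2} with hS1
    change _ ≤ _ * (rowM d).real S1 at sb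
    set S2 := {v : Fin d → ℝ | ∀ j, |v j| ≤ d}
    have hS1m : MeasurableSet S1 :=
      measurableSet_le measurable_const ((comb_cont hφ _ _ _).pow 2).measurable
    push_cast at sb
    have hP : q + 1 / (d:ℝ) ^ 2 ≤ (rowM d).real S1 := by
      have := hq.trans sb
      exact le_of_mul_le_mul_left this (by positivity)
    rw [Set.compl_inter]
    have h1 : (rowM d).real (S1ᶜ ∪ S2ᶜ) ≤ 1 - q := by
      refine (measureReal_union_le _ _).trans ?_
      rw [probReal_compl_eq_one_sub hS1m]
      linarith
    rw [← ofReal_measureReal]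
    exact ENNReal.ofReal_le_ofReal h1
  · intro w hw w' hw' hww v hv hE'
    have := comb_diff hΛ hb hL X hX hw'.1 hw.2.1 (by positivity : 0 ≤ 1 / (d:ℝ) ^ 5)
      (xh := (pr w).1) (θ := (pr w).2) (xh' := (pr w').1) (θ' := (pr w').2)
      (fun j => hww (Sum.inl j)) (fun i => hww (Sum.inr i)) v hE'.2
    have hv0 : comb φ X (pr w).1 (pr w).2 v = 0 := hv
    rw [hv0, zero_sub, abs_neg] at this
    have h3 := pow_le_pow_left₀ (abs_nonneg _) this 2
    rw [sq_abs] at h3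
    have h4 : δ₀ / 2 ≤ comb φ X (pr w').1 (pr w').2 v ^ 2 := hE'.1
    linarith

/-! ### Numerical asymptotics -/

lemma num_union {c C k : ℝ} (hc : 0 < c) (hk : 0 < k) {d n p : ℕ} (hd : 2 ≤ d)
    (hn1 : 1 ≤ n) (hn : (n:ℝ) ≤ C * d)
    (hp : (8 * (2 + C) + k + 1) / c * (n * d * Real.log d ^ 2) ≤ p) :
    ((2 * d ^ 6 + 1 : ℕ) : ENNReal) ^ (d + n + 1) * ENNReal.ofReal (1 - c / (n * Real.log d)) ^ p
      ≤ ENNReal.ofReal ((d:ℝ) ^ (-k) / 2) := by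
  have hd2 : (2:ℝ) ≤ d := by exact_mod_cast hd
  have hd0 : (0:ℝ) < d := by linarith
  have hn0 : (1:ℝ) ≤ n := by exact_mod_cast hn1
  have hl : 0 < Real.log d := Real.log_pos (by linarith)
  set q := c / (n * Real.log d) with hq
  have h1 : ((2 * d ^ 6 + 1 : ℕ) : ENNReal) ≤ ENNReal.ofReal (Real.exp (8 * Real.log d)) := by
    rw [← ENNReal.ofReal_natCast]
    apply ENNReal.ofReal_le_ofReal
    have : Real.exp (8 * Real.log d) = (d:ℝ) ^ 8 := by
      rw [mul_comm, Real.exp_mul, Real.exp_log hd0]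
      exact_mod_cast Real.rpow_natCast (d:ℝ) 8
    rw [this]
    push_cast
    have h6 : (1:ℝ) ≤ (d:ℝ) ^ 6 := one_le_pow₀ (by linarith)
    have h8 : (d:ℝ) ^ 8 = d ^ 6 * d ^ 2 := by ring
    rw [h8]
    nlinarith [mul_self_nonneg ((d:ℝ) - 2)]
  have h2 : ENNReal.ofReal (1 - q) ≤ ENNReal.ofReal (Real.exp (-q)) := by
    apply ENNReal.ofReal_le_ofReal
    linarith [Real.add_one_le_exp (-q)]
  calc _ ≤ ENNReal.ofReal (Real.exp (8 * Real.log d)) ^ (d + n + 1) * ENNReal.ofReal (Real.exp (-q)) ^ p :=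
        mul_le_mul' (pow_le_pow_left' h1 _) (pow_le_pow_left' h2 _)
    _ = ENNReal.ofReal (Real.exp ((d + n + 1 : ℕ) * (8 * Real.log d) + p * (-q))) := by
        rw [← ENNReal.ofReal_pow (Real.exp_pos _).le, ← ENNReal.ofReal_pow (Real.exp_pos _).le,
          ← ENNReal.ofReal_mul (by positivity), ← Real.exp_nat_mul, ← Real.exp_nat_mul, Real.exp_add]
    _ ≤ ENNReal.ofReal (Real.exp (-(k + 1) * Real.log d)) := by
        apply ENNReal.ofReal_le_ofReal
        apply Real.exp_le_exp.2
        have h3 : (8 * (2 + C) + k + 1) * d * Real.log d ≤ p * q := by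
          calc _ = (8 * (2 + C) + k + 1) / c * (n * d * Real.log d ^ 2) * q := by
                rw [hq]; field_simp
            _ ≤ _ := mul_le_mul_of_nonneg_right hp (by positivity)
        push_cast
        have h4 : ((d:ℝ) + n + 1) * (8 * Real.log d) ≤ (8 * (2 + C)) * d * Real.log d := by
          have : (d:ℝ) + n + 1 ≤ (2 + C) * d := by linarith
          nlinarith
        have h5 : (k + 1) * Real.log d ≤ (k + 1) * d * Real.log d := by
          have : (k + 1) ≤ (k + 1) * d := by nlinarith
          exact mul_le_mul_of_nonneg_right this hl.le
        nlinarith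
    _ ≤ _ := by
        apply ENNReal.ofReal_le_ofReal
        rw [mul_comm, Real.exp_mul, Real.exp_log hd0, neg_add, Real.rpow_add hd0, Real.rpow_neg_one,
          div_eq_mul_inv]
        gcongr

lemma num_event {Λ lam I δ₀ δ C : ℝ} (hlam : 0 < lam) (hΛ : 0 < Λ) (hI : 0 ≤ I) (hδ₀ : 0 < δ₀)
    (hδ : 0 < δ) (hC : 1 ≤ C) :
    ∀ᶠ d : ℕ in atTop, 2 ≤ d ∧ ((d:ℝ) ^ (-(2/5) : ℝ) ≤ 1) ∧ ∀ n : ℕ, 1 ≤ n → (n:ℝ) ≤ C * d →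
      (n:ℝ) * ((d:ℝ) ^ (-(2/5) : ℝ)) ^ 3 ≤ δ / 4 ∧
      (1 / (d:ℝ) ^ 5 * (Λ * ((n + 1) * (1 + (d:ℝ) ^ 2) + (d:ℝ) ^ 2))) ^ 2 < δ₀ / 2 ∧
      ((n:ℝ) + 1) * (2 / lam * Real.log d) * ((δ₀ * lam / 16) / (n * Real.log d) + 1 / (d:ℝ) ^ 2) ≤
        δ₀ / 2 - (n + 1) * (Real.exp (-(lam * (2 / lam * Real.log d))) / lam * I) := by
  have t1 : Tendsto (fun d : ℕ => C * (d:ℝ) ^ (-(1/5) : ℝ)) atTop (nhds (C * 0)) :=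
    ((tendsto_rpow_neg_atTop (by norm_num)).comp tendsto_natCast_atTop_atTop).const_mul C
  have tinv : Tendsto (fun d : ℕ => ((d:ℝ))⁻¹) atTop (nhds 0) := tendsto_inv_atTop_nhds_zero_nat
  have t2 : Tendsto (fun d : ℕ => (5 * C * Λ * (d:ℝ)⁻¹) ^ 2) atTop (nhds ((5 * C * Λ * 0) ^ 2)) :=
    (tinv.const_mul _).pow 2
  have tlog : Tendsto (fun d : ℕ => Real.log d / (d:ℝ)) atTop (nhds 0) :=
    (Real.isLittleO_log_id_atTop.tendsto_div_nhds_zero).comp tendsto_natCast_atTop_atTop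
  have t3 : Tendsto (fun d : ℕ => 2 * C / lam * (2 * (Real.log d / (d:ℝ)) + I * (d:ℝ)⁻¹)) atTop
      (nhds (2 * C / lam * (2 * 0 + I * 0))) :=
    ((tlog.const_mul 2).add (tinv.const_mul I)).const_mul _
  simp only [mul_zero, add_zero, ne_eq, OfNat.ofNat_ne_zero, not_false_eq_true, zero_pow] at t1 t2 t3
  filter_upwards [eventually_ge_atTop 2, t1.eventually_lt_const (by positivity : (0:ℝ) < δ / 4),
    t2.eventually_lt_const (by positivity : (0:ℝ) < δ₀ / 2),
    t3.eventually_lt_const (by positivity : (0:ℝ) < δ₀ / 4)] with d hd e1 e2 e3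
  have hd2 : (2:ℝ) ≤ d := by exact_mod_cast hd
  have hd0 : (0:ℝ) < d := by linarith
  have hl : 0 < Real.log d := Real.log_pos (by linarith)
  refine ⟨hd, Real.rpow_le_one_of_one_le_of_nonpos (by linarith) (by norm_num), fun n hn1 hn => ?_⟩
  have hn0 : (1:ℝ) ≤ n := by exact_mod_cast hn1
  have hn2 : (n:ℝ) + 1 ≤ 2 * C * d := by linarith
  refine ⟨?_, ?_, ?_⟩
  · have : ((d:ℝ) ^ (-(2/5) : ℝ)) ^ 3 = (d:ℝ)⁻¹ * (d:ℝ) ^ (-(1/5) : ℝ) := by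
      rw [← Real.rpow_natCast, ← Real.rpow_mul hd0.le, ← Real.rpow_neg_one, ← Real.rpow_add hd0]
      norm_num
    rw [this]
    refine le_trans ?_ e1.le
    calc (n:ℝ) * ((d:ℝ)⁻¹ * (d:ℝ) ^ (-(1/5) : ℝ)) ≤ (C * d) * ((d:ℝ)⁻¹ * (d:ℝ) ^ (-(1/5) : ℝ)) := by gcongr
      _ = _ := by field_simp
  · refine lt_of_le_of_lt ?_ e2
    apply pow_le_pow_left₀ (by positivity)
    have h1 : ((n:ℝ) + 1) * (1 + (d:ℝ) ^ 2) + (d:ℝ) ^ 2 ≤ 5 * C * d ^ 3 := by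
      have a1 : 1 + (d:ℝ) ^ 2 ≤ 2 * d ^ 2 := by nlinarith
      have a2 : ((n:ℝ) + 1) * (1 + (d:ℝ) ^ 2) ≤ 2 * C * d * (2 * d ^ 2) := by gcongr
      have a3 : (d:ℝ) ^ 2 ≤ C * d ^ 3 := by
        have : 1 ≤ C * d := by nlinarith
        nlinarith [sq_nonneg (d:ℝ)]
      nlinarith
    calc 1 / (d:ℝ) ^ 5 * (Λ * (((n:ℝ) + 1) * (1 + (d:ℝ) ^ 2) + (d:ℝ) ^ 2))
        ≤ 1 / (d:ℝ) ^ 5 * (Λ * (5 * C * d ^ 3)) := by gcongr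
      _ = 5 * C * Λ * ((d:ℝ)⁻¹ * (d:ℝ)⁻¹) := by field_simp
      _ ≤ 5 * C * Λ * ((d:ℝ)⁻¹ * 1) := by
          gcongr
          exact inv_le_one_of_one_le₀ (by linarith)
      _ = _ := by ring
  · have hexp : Real.exp (-(lam * (2 / lam * Real.log d))) = 1 / (d:ℝ) ^ 2 := by
      have : -(lam * (2 / lam * Real.log d)) = -(Real.log ((d:ℝ) ^ 2)) := by
        rw [Real.log_pow]; push_cast; field_simp
      rw [this, Real.exp_neg, Real.exp_log (by positivity), one_div]
    rw [hexp]
    have b1 : ((n:ℝ) + 1) * (2 / lam * Real.log d) * ((δ₀ * lam / 16) / (n * Real.log d)) ≤ δ₀ / 4 := by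
      calc _ ≤ ((n:ℝ) + n) * (2 / lam * Real.log d) * ((δ₀ * lam / 16) / (n * Real.log d)) := by gcongr
        _ = δ₀ / 4 := by field_simp; ring
    have b2 : ((n:ℝ) + 1) * ((2 / lam * Real.log d) * (1 / (d:ℝ) ^ 2) + 1 / (d:ℝ) ^ 2 / lam * I) ≤ δ₀ / 4 := by
      calc _ ≤ (2 * C * d) * ((2 / lam * Real.log d) * (1 / (d:ℝ) ^ 2) + 1 / (d:ℝ) ^ 2 / lam * I) := by gcongr
        _ = 2 * C / lam * (2 * (Real.log d / (d:ℝ)) + I * (d:ℝ)⁻¹) := by field_simp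
        _ ≤ _ := e3.le
    linarith [b1, b2]

/-! ### The data event -/

lemma dotp_sq_le_of_unit {d : ℕ} {u x : Fin d → ℝ} (hu : eNorm u = 1) (hx : eNorm x = Real.sqrt d) :
    dotp u x ^ 2 ≤ d := by
  have h := dotp_cs u x
  rw [← eNorm_sq u, hu, (eNorm_eq_iff x).1 hx] at h
  linarith

lemma dotp_cont_right {d : ℕ} (u : Fin d → ℝ) : Continuous (fun x : Fin d → ℝ => dotp u x) := by
  unfold dotp; fun_prop

lemma exp_dotp_integrable {d : ℕ} {P : Measure (Fin d → ℝ)} {K : ℝ} (h : DataAssumption P K)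
    {u : Fin d → ℝ} (hu : eNorm u = 1) (t : ℝ) :
    Integrable (fun x => Real.exp (dotp u x ^ 2 / t ^ 2)) P := by
  have := h.prob
  refine Integrable.of_bound (C := Real.exp (d / t ^ 2)) ?_ ?_
  · have := dotp_cont_right u
    exact (by fun_prop : Continuous fun x => Real.exp (dotp u x ^ 2 / t ^ 2)).aestronglyMeasurable
  · filter_upwards [h.norm_eq] with x hx
    rw [Real.norm_eq_abs, abs_of_pos (Real.exp_pos _)]
    apply Real.exp_le_exp.2
    gcongr
    exact dotp_sq_le_of_unit hu hx

lemma exp_moment {d : ℕ} (hd : 0 < d) {P : Measure (Fin d → ℝ)} {K : ℝ} (h : DataAssumption P K)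
    {u : Fin d → ℝ} (hu : eNorm u = 1) :
    ∫ x, Real.exp (dotp u x ^ 2 / (|K| + 1) ^ 2) ∂P ≤ 2 := by
  have := h.prob
  have hd' : (0:ℝ) < d := by positivity
  have hlog : 0 < Real.log 2 := Real.log_pos (by norm_num)
  set t₀ := Real.sqrt (d / Real.log 2) with ht₀
  have ht₀p : 0 < t₀ := Real.sqrt_pos.2 (by positivity)
  have ht₀sq : t₀ ^ 2 = d / Real.log 2 := Real.sq_sqrt (by positivity)
  have hmem : ∀ w : Fin d → ℝ, eNorm w = 1 →
      t₀ ∈ {t : ℝ | 0 < t ∧ ∫ x, Real.exp ((dotp w x) ^ 2 / t ^ 2) ∂P ≤ 2} := by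
    intro w hw
    refine ⟨ht₀p, ?_⟩
    have h1 : ∫ x, Real.exp ((dotp w x) ^ 2 / t₀ ^ 2) ∂P ≤ ∫ x, (2:ℝ) ∂P := by
      refine integral_mono_ae (exp_dotp_integrable h hw _) (integrable_const _) ?_
      filter_upwards [h.norm_eq] with x hx
      have h2 : dotp w x ^ 2 / t₀ ^ 2 ≤ Real.log 2 := by
        rw [div_le_iff₀ (by positivity), ht₀sq]
        have := dotp_sq_le_of_unit hw hx
        have e : Real.log 2 * (d / Real.log 2) = d := by field_simp
        linarith
      calc _ ≤ Real.exp (Real.log 2) := Real.exp_le_exp.2 h2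
        _ = 2 := Real.exp_log (by norm_num)
    simpa using h1
  have hbdd : BddAbove (Set.range fun w : {u : Fin d → ℝ // eNorm u = 1} =>
      sInf {t : ℝ | 0 < t ∧ ∫ x, Real.exp ((dotp w.1 x) ^ 2 / t ^ 2) ∂P ≤ 2}) := by
    refine ⟨t₀, ?_⟩
    rintro _ ⟨w, rfl⟩
    exact csInf_le ⟨0, fun t ht => ht.1.le⟩ (hmem w.1 w.2)
  have hle : sInf {t : ℝ | 0 < t ∧ ∫ x, Real.exp ((dotp u x) ^ 2 / t ^ 2) ∂P ≤ 2} ≤ K :=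
    (le_ciSup hbdd ⟨u, hu⟩).trans h.subg
  obtain ⟨t, ⟨ht0, ht⟩, htK⟩ := exists_lt_of_csInf_lt ⟨t₀, hmem u hu⟩
    (lt_of_le_of_lt hle (by linarith [le_abs_self K] : K < |K| + 1))
  refine le_trans ?_ ht
  refine integral_mono (exp_dotp_integrable h hu _) (exp_dotp_integrable h hu _) fun x => ?_
  apply Real.exp_le_exp.2
  gcongr

lemma tail_unit {d : ℕ} (hd : 0 < d) {P : Measure (Fin d → ℝ)} {K : ℝ} (h : DataAssumption P K)
    {x₀ : Fin d → ℝ} (hx₀ : eNorm x₀ = Real.sqrt d) {τ : ℝ} (hτ : 0 ≤ τ) :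
    P {x | τ * d < |dotp x₀ x|} ≤ ENNReal.ofReal (2 * Real.exp (-(τ ^ 2 * d / (|K| + 1) ^ 2))) := by
  have := h.prob
  have hd' : (0:ℝ) < d := by positivity
  have hsq : 0 < Real.sqrt d := Real.sqrt_pos.2 hd'
  have hsq2 : Real.sqrt d ^ 2 = d := Real.sq_sqrt hd'.le
  set u : Fin d → ℝ := fun j => x₀ j / Real.sqrt d with hu
  have hdot : ∀ x, dotp u x = dotp x₀ x / Real.sqrt d := by
    intro x; simp only [dotp, hu, Finset.sum_div]
    exact Finset.sum_congr rfl fun i _ => by ring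
  have hun : eNorm u = 1 := by
    have h1 : eNorm u ^ 2 = 1 := by
      rw [eNorm_sq, hdot]
      have : dotp x₀ u = dotp x₀ x₀ / Real.sqrt d := by
        simp only [dotp, hu, Finset.sum_div]
        exact Finset.sum_congr rfl fun i _ => by ring
      rw [this, (eNorm_eq_iff x₀).1 hx₀, div_div, ← sq, hsq2, div_self hd'.ne']
    have := eNorm_nonneg u
    nlinarith
  set a := Real.exp (τ ^ 2 * d / (|K| + 1) ^ 2) with ha
  have hM := mul_meas_ge_le_integral_of_nonneg (μ := P)
    (f := fun x => Real.exp (dotp u x ^ 2 / (|K| + 1) ^ 2))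
    (ae_of_all _ fun v => (Real.exp_pos _).le) (exp_dotp_integrable h hun _) a
  have hsub : {x | τ * d < |dotp x₀ x|} ⊆ {x | a ≤ Real.exp (dotp u x ^ 2 / (|K| + 1) ^ 2)} := by
    intro x hx
    have hx' : τ * d < |dotp x₀ x| := hx
    show a ≤ _
    apply Real.exp_le_exp.2
    gcongr
    rw [hdot, div_pow, hsq2, le_div_iff₀ hd', ← sq_abs (dotp x₀ x)]
    have := pow_le_pow_left₀ (by positivity) hx'.le 2
    linarith [this, (by ring : (τ * d) ^ 2 = τ ^ 2 * d * d)]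
  have h2 := measureReal_mono (μ := P) hsub
  have hE := exp_moment hd h hun
  rw [← ofReal_measureReal]
  apply ENNReal.ofReal_le_ofReal
  rw [Real.exp_neg, ← ha]
  have hap : 0 < a := Real.exp_pos _
  rw [← div_eq_mul_inv, le_div_iff₀ hap]
  nlinarith

lemma pair_bound {d n : ℕ} (hd : 0 < d) {P : Measure (Fin d → ℝ)} {K : ℝ} (h : DataAssumption P K)
    {τ : ℝ} (hτ : 0 ≤ τ) {i j : Fin n} (hij : i ≠ j) :
    (Measure.pi fun _ : Fin n => P) {X | τ * d < |dotp (X i) (X j)|} ≤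
      ENNReal.ofReal (2 * Real.exp (-(τ ^ 2 * d / (|K| + 1) ^ 2))) := by
  have := h.prob
  have hc : Continuous fun z : (Fin d → ℝ) × (Fin d → ℝ) => |dotp z.1 z.2| := by
    unfold dotp; fun_prop
  have hm : MeasurableSet {z : (Fin d → ℝ) × (Fin d → ℝ) | τ * d < |dotp z.1 z.2|} :=
    measurableSet_lt measurable_const hc.measurable
  have hind : IndepFun (fun X : Fin n → Fin d → ℝ => X i) (fun X => X j) (Measure.pi fun _ : Fin n => P) :=
    (iIndepFun_pi (X := fun _ : Fin n => (id : (Fin d → ℝ) → (Fin d → ℝ)))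
      fun _ => aemeasurable_id).indepFun hij
  have hmap := (indepFun_iff_map_prod_eq_prod_map_map (measurable_pi_apply i).aemeasurable
    (measurable_pi_apply j).aemeasurable).1 hind
  have e1 : ∀ i : Fin n, (Measure.pi fun _ : Fin n => P).map (fun X => X i) = P := fun i =>
    (measurePreserving_eval (fun _ : Fin n => P) i).map_eq
  rw [e1, e1] at hmap
  have : (Measure.pi fun _ : Fin n => P) {X | τ * d < |dotp (X i) (X j)|} =
      (P.prod P) {z : (Fin d → ℝ) × (Fin d → ℝ) | τ * d < |dotp z.1 z.2|} := by
    rw [← hmap, Measure.map_apply ((measurable_pi_apply i).prodMk (measurable_pi_apply j)) hm]; rfl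
  rw [this, Measure.prod_apply hm]
  calc _ ≤ ∫⁻ x, ENNReal.ofReal (2 * Real.exp (-(τ ^ 2 * d / (|K| + 1) ^ 2))) ∂P := by
        apply lintegral_mono_ae
        filter_upwards [h.norm_eq] with x hx
        exact tail_unit hd h hx hτ
    _ = _ := by simp

lemma data_bound {d n : ℕ} (hd : 0 < d) {P : Measure (Fin d → ℝ)} {K : ℝ} (h : DataAssumption P K)
    {τ : ℝ} (hτ : 0 ≤ τ) :
    (Measure.pi fun _ : Fin n => P) {X | ¬ Xgood τ X} ≤
      ENNReal.ofReal ((n:ℝ) ^ 2 * (2 * Real.exp (-(τ ^ 2 * d / (|K| + 1) ^ 2)))) := by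
  have := h.prob
  set b := 2 * Real.exp (-(τ ^ 2 * d / (|K| + 1) ^ 2)) with hb
  have hb0 : 0 ≤ b := by positivity
  have hnorm : (Measure.pi fun _ : Fin n => P) {X | ¬ ∀ i, dotp (X i) (X i) = d} = 0 := by
    rw [← mem_ae_iff.trans (by rfl : _ ↔ (Measure.pi fun _ : Fin n => P) {X | ¬ ∀ i, dotp (X i) (X i) = d} = 0)]
    change ∀ᵐ X ∂(Measure.pi fun _ : Fin n => P), ∀ i, dotp (X i) (X i) = d
    rw [ae_all_iff]
    intro i
    have hq := (measurePreserving_eval (fun _ : Fin n => P) i).quasiMeasurePreserving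
    filter_upwards [hq.ae h.norm_eq] with X hX
    exact (eNorm_eq_iff _).1 hX
  have hsub : {X : Fin n → Fin d → ℝ | ¬ Xgood τ X} ⊆ {X | ¬ ∀ i, dotp (X i) (X i) = d} ∪
      ⋃ i : Fin n, ⋃ j : Fin n, (if i ≠ j then {X | τ * d < |dotp (X i) (X j)|} else ∅) := by
    intro X hX
    by_cases h1 : ∀ i, dotp (X i) (X i) = d
    · right
      have hX' : ¬ Xgood τ X := hX
      simp only [Xgood, h1, implies_true, true_and, not_forall, not_le] at hX'
      obtain ⟨i, j, hij, hlt⟩ := hX'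
      simp only [Set.mem_iUnion]
      refine ⟨i, j, ?_⟩
      rw [if_pos hij]; exact hlt
    · left; exact h1
  refine (measure_mono hsub).trans ((measure_union_le _ _).trans ?_)
  rw [hnorm, zero_add]
  calc _ ≤ ∑ i : Fin n, ∑ j : Fin n, ENNReal.ofReal b := by
        refine (measure_iUnion_fintype_le _ _).trans (Finset.sum_le_sum fun i _ => ?_)
        refine (measure_iUnion_fintype_le _ _).trans (Finset.sum_le_sum fun j _ => ?_)
        by_cases hij : i ≠ j
        · rw [if_pos hij]; exact pair_bound hd h hτ hij
        · rw [if_neg hij]; simp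
    _ = _ := by
        rw [ENNReal.ofReal_mul (p := (n:ℝ) ^ 2) (q := b) (by positivity),
          ENNReal.ofReal_pow (by positivity)]
        simp [sq, mul_assoc]

lemma num_data {K C k : ℝ} (hC : 1 ≤ C) :
    ∀ᶠ d : ℕ in atTop, ∀ n : ℕ, (n:ℝ) ≤ C * d →
      (n:ℝ) ^ 2 * (2 * Real.exp (-(((d:ℝ) ^ (-(2/5) : ℝ)) ^ 2 * d / (|K| + 1) ^ 2))) ≤ (d:ℝ) ^ (-k) / 2 := by
  set b := 1 / (|K| + 1) ^ 2 with hb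
  have hbp : 0 < b := by positivity
  have t0 : Tendsto (fun d : ℕ => (d:ℝ) ^ (1/5 : ℝ)) atTop atTop :=
    (tendsto_rpow_atTop (by norm_num)).comp tendsto_natCast_atTop_atTop
  have t1 := (tendsto_rpow_mul_exp_neg_mul_atTop_nhds_zero (5 * (k + 2)) b hbp).comp t0
  have t2 := t1.eventually_le_const (by positivity : (0:ℝ) < 1 / (4 * C ^ 2))
  filter_upwards [t2, eventually_ge_atTop 1] with d e1 hd n hn
  have hd0 : (0:ℝ) < d := by exact_mod_cast hd
  simp only [Function.comp] at e1
  rw [← Real.rpow_mul hd0.le, (by ring : (1/5 : ℝ) * (5 * (k + 2)) = k + 2)] at e1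
  have e2 : ((d:ℝ) ^ (-(2/5) : ℝ)) ^ 2 * d / (|K| + 1) ^ 2 = b * (d:ℝ) ^ (1/5 : ℝ) := by
    have : ((d:ℝ) ^ (-(2/5) : ℝ)) ^ 2 * d = (d:ℝ) ^ (1/5 : ℝ) := by
      nth_rewrite 2 [← Real.rpow_one (d:ℝ)]
      rw [← Real.rpow_natCast, ← Real.rpow_mul hd0.le, ← Real.rpow_add hd0]
      norm_num
    rw [this, hb]; ring
  rw [e2, ← neg_mul]
  set x := Real.exp (-b * (d:ℝ) ^ (1/5 : ℝ)) with hx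
  have hx0 : 0 < x := Real.exp_pos _
  have hsplit : (d:ℝ) ^ (k + 2) = (d:ℝ) ^ k * (d:ℝ) ^ 2 := by
    rw [Real.rpow_add hd0]; norm_num
  rw [hsplit, le_div_iff₀ (by positivity)] at e1
  rw [Real.rpow_neg hd0.le, le_div_iff₀ (by norm_num), ← one_div, le_div_iff₀ (by positivity)]
  have hn2 : (n:ℝ) ^ 2 ≤ (C * d) ^ 2 := pow_le_pow_left₀ (by positivity) hn 2
  calc (n:ℝ) ^ 2 * (2 * x) * 2 * (d:ℝ) ^ k ≤ (C * d) ^ 2 * (2 * x) * 2 * (d:ℝ) ^ k := by gcongr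
    _ = (d:ℝ) ^ k * (d:ℝ) ^ 2 * x * (4 * C ^ 2) := by ring
    _ ≤ 1 := e1

/-! ### Combination -/

lemma exists_theta {p n : ℕ} (w : Fin (n + 1) → Fin p → ℝ) (g : Fin n → Fin p → ℝ)
    (h : ∀ i, w i ∈ Submodule.span ℝ (Set.range g)) :
    ∃ θ : Fin (n + 1) → ℝ, ∑ i, θ i ^ 2 = 1 ∧ ∀ k, ∑ i, θ i * w i k = 0 := by
  classical
  have hli : ¬ LinearIndependent ℝ w := by
    intro hli
    have h1 := linearIndependent_le_span_aux' w hli (Set.range g) (by rintro _ ⟨i, rfl⟩; exact h i)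
    have h2 : Fintype.card (Set.range g) ≤ Fintype.card (Fin n) := Fintype.card_range_le g
    simp only [Fintype.card_fin] at h1 h2
    omega
  rw [Fintype.not_linearIndependent_iff] at hli
  obtain ⟨a, ha, i0, hi0⟩ := hli
  have hpos : 0 < ∑ i, a i ^ 2 :=
    Finset.sum_pos' (fun i _ => sq_nonneg _) ⟨i0, Finset.mem_univ _, by positivity⟩
  refine ⟨fun i => a i / Real.sqrt (∑ i, a i ^ 2), ?_, fun k => ?_⟩
  · simp_rw [div_pow, Real.sq_sqrt hpos.le]
    rw [← Finset.sum_div, div_self hpos.ne']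
  · have := congrFun ha k
    simp only [Finset.sum_apply, Pi.smul_apply, smul_eq_mul, Pi.zero_apply] at this
    simp_rw [div_mul_eq_mul_div]
    rw [← Finset.sum_div, this, zero_div]

/-- The bad event. -/
def badSet (φ : ℝ → ℝ) (p d n : ℕ) (η τ : ℝ) : Set ((Fin p → Fin d → ℝ) × (Fin n → Fin d → ℝ)) :=
  {ω | Xgood τ ω.2 ∧ ∃ z ∈ Kset η ω.2, ∀ k, comb φ ω.2 z.1 z.2 (ω.1 k) = 0}

lemma isClosed_forall' {α : Type*} [TopologicalSpace α] {ι : Sort*} {q : ι → α → Prop}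
    (h : ∀ i, IsClosed {x | q i x}) : IsClosed {x | ∀ i, q i x} := by
  have : {x | ∀ i, q i x} = ⋂ i, {x | q i x} := by ext; simp
  rw [this]; exact isClosed_iInter h

lemma dotp_cont2 {α : Type*} [TopologicalSpace α] {d : ℕ} {f g : α → Fin d → ℝ} (hf : Continuous f)
    (hg : Continuous g) : Continuous fun a => dotp (f a) (g a) := by
  unfold dotp; fun_prop

lemma badSet_closed {φ : ℝ → ℝ} (hφ : Continuous φ) (p d n : ℕ) (η τ : ℝ) :
    IsClosed (badSet φ p d n η τ) := by
  let Bl : Set ((Fin d → ℝ) × (Fin (n + 1) → ℝ)) := Metric.closedBall 0 (d + 1)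
  have : CompactSpace Bl := isCompact_iff_compactSpace.1 (isCompact_closedBall _ _)
  let T : Set (Bl × ((Fin p → Fin d → ℝ) × (Fin n → Fin d → ℝ))) :=
    {t | Xgood τ t.2.2 ∧ t.1.1 ∈ Kset η t.2.2 ∧ ∀ k, comb φ t.2.2 t.1.1.1 t.1.1.2 (t.2.1 k) = 0}
  have hT : IsClosed T := by
    have c1 : Continuous fun t : Bl × ((Fin p → Fin d → ℝ) × (Fin n → Fin d → ℝ)) => t.1.1.1 := by
      fun_prop
    have c2 : Continuous fun t : Bl × ((Fin p → Fin d → ℝ) × (Fin n → Fin d → ℝ)) => t.1.1.2 := by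
      fun_prop
    have c3 : ∀ i, Continuous fun t : Bl × ((Fin p → Fin d → ℝ) × (Fin n → Fin d → ℝ)) => t.2.2 i := by
      intro i; fun_prop
    have c4 : ∀ i, Continuous fun t : Bl × ((Fin p → Fin d → ℝ) × (Fin n → Fin d → ℝ)) => t.2.1 i := by
      intro i; fun_prop
    have hgood : IsClosed {t : Bl × ((Fin p → Fin d → ℝ) × (Fin n → Fin d → ℝ)) | Xgood τ t.2.2} := by
      unfold Xgood
      refine IsClosed.and ?_ ?_
      · exact isClosed_forall' fun i => isClosed_eq (dotp_cont2 (c3 i) (c3 i)) continuous_const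
      · exact isClosed_forall' fun i => isClosed_forall' fun j => isClosed_forall' fun _ =>
          isClosed_le (dotp_cont2 (c3 i) (c3 j)).abs continuous_const
    have hK : IsClosed {t : Bl × ((Fin p → Fin d → ℝ) × (Fin n → Fin d → ℝ)) |
        t.1.1 ∈ Kset η t.2.2} := by
      unfold Kset
      simp only [Set.mem_ofPred_eq]
      refine IsClosed.and (isClosed_eq (dotp_cont2 c1 c1) continuous_const) (IsClosed.and ?_ ?_)
      · exact isClosed_eq (by fun_prop) continuous_const
      · exact isClosed_forall' fun i =>
          isClosed_le continuous_const (dotp_cont2 (c1.sub (c3 i)) (c1.sub (c3 i)))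
    refine hgood.and (hK.and ?_)
    refine isClosed_forall' fun k => isClosed_eq ?_ continuous_const
    unfold comb
    refine continuous_finsetSum _ fun i _ => ((continuous_apply i).comp c2).mul (hφ.comp ?_)
    refine dotp_cont2 (c4 k) ?_
    refine Fin.cases ?_ (fun i => ?_) i
    · simpa using c1
    · simpa using c3 i
  have himg : badSet φ p d n η τ = Prod.snd '' T := by
    ext ω
    constructor
    · rintro ⟨h1, z, hz, h2⟩
      refine ⟨(⟨z, ?_⟩, ω), ⟨h1, hz, h2⟩, rfl⟩
      obtain ⟨z1, z2, -⟩ := hz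
      rw [mem_closedBall_zero_iff, Prod.norm_def, max_le_iff]
      have hd : (0:ℝ) ≤ d := by positivity
      constructor
      · rw [pi_norm_le_iff_of_nonneg (by positivity)]
        intro j
        rw [Real.norm_eq_abs]
        apply abs_le_of_sq_le_sq _ (by positivity)
        have : z.1 j ^ 2 ≤ d := by
          rw [← z1]; unfold dotp; simp only [← sq]
          exact Finset.single_le_sum (f := fun j => z.1 j ^ 2) (fun i _ => sq_nonneg _) (Finset.mem_univ j)
        nlinarith
      · rw [pi_norm_le_iff_of_nonneg (by positivity)]
        intro j
        rw [Real.norm_eq_abs]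
        apply abs_le_of_sq_le_sq _ (by positivity)
        have : z.2 j ^ 2 ≤ 1 := by
          rw [← z2]
          exact Finset.single_le_sum (f := fun j => z.2 j ^ 2) (fun i _ => sq_nonneg _) (Finset.mem_univ j)
        nlinarith
    · rintro ⟨⟨z, ω'⟩, ⟨h1, h2, h3⟩, rfl⟩
      exact ⟨h1, z.1, h2, h3⟩
  rw [himg]
  exact isClosedMap_snd_of_compactSpace _ hT

lemma good_sub (φ : ℝ → ℝ) {p d n : ℕ} {η τ : ℝ} (hη : 0 < η)
    (ω : (Fin p → Fin d → ℝ) × (Fin n → Fin d → ℝ)) (hg : Xgood τ ω.2) (hb : ω ∉ badSet φ p d n η τ)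
    (Xh : Fin n → Fin d → ℝ) (hX : ∀ j, eNorm (Xh j) = Real.sqrt d)
    (hs : ∀ i, featureMap φ ω.1 (ω.2 i) ∈
      Submodule.span ℝ (Set.range fun j => featureMap φ ω.1 (Xh j))) (jh : Fin n) :
    ∃ i : Fin n, eNorm (Xh jh - ω.2 i) ≤ η * Real.sqrt d := by
  by_contra hcon
  push Not at hcon
  apply hb
  obtain ⟨θ, h1, h2⟩ := exists_theta
    (fun i => featureMap φ ω.1 ((Fin.cons (Xh jh) ω.2 : Fin (n + 1) → Fin d → ℝ) i))
    (fun j => featureMap φ ω.1 (Xh j)) (by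
      intro i
      refine Fin.cases ?_ (fun i => ?_) i
      · exact Submodule.subset_span ⟨jh, rfl⟩
      · exact hs i)
  refine ⟨hg, (Xh jh, θ), ⟨(eNorm_eq_iff _).1 (hX jh), h1, fun i => ?_⟩, h2⟩
  have := pow_le_pow_left₀ (by positivity) (hcon i).le 2
  rw [mul_pow, Real.sq_sqrt (by positivity), eNorm_sq] at this
  exact this

lemma growth_memLp {φ : ℝ → ℝ} (hφ : Continuous φ) {Λ : ℝ}
    (hb : ∀ t, |φ t| ≤ Λ * (1 + |t|)) : MemLp φ 2 gam := by
  have h1 : MemLp (fun t : ℝ => Λ * (1 + |t|)) 2 gam := by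
    have h2 : MemLp (fun t : ℝ => |t|) 2 gam := (memLp_id_gaussianReal (μ := 0) (v := 1) 2).abs
    have h3 : MemLp (fun _ : ℝ => (1:ℝ)) 2 gam := memLp_const 1
    exact (h3.add h2).const_mul Λ
  exact h1.mono' hφ.aestronglyMeasurable (ae_of_all _ fun t => by
    rw [Real.norm_eq_abs]; exact hb t)

/-- **Theorem 1 (Law of data reconstruction for random features).**
Under the random features setup and the data, activation, and scaling assumptions:
for every `η > 0` and `k > 0` there exists `D` such that for all `d ≥ D`, with probability
at least `1 − d^{−k}` over `V` and the data, every `X̂` with rows of norm `√d` whose feature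
span contains all training features has each of its rows within `η √d` of a training sample. -/
theorem law_of_data_reconstruction
    (φ : ℝ → ℝ) (hφ : ActivationAssumption φ)
    (K C₀ : ℝ)
    (n p : ℕ → ℕ)
    (P : (d : ℕ) → Measure (Fin d → ℝ))
    (hdata : ∀ d, DataAssumption (P d) K)
    (hn : ∀ d : ℕ, (n d : ℝ) ≤ C₀ * d)
    (hp : Tendsto (fun d : ℕ => (p d : ℝ) / ((n d : ℝ) * d * (Real.log d) ^ 2))
      atTop atTop) :
    ∀ η : ℝ, 0 < η → ∀ k : ℝ, 0 < k → ∃ D : ℕ, ∀ d : ℕ, D ≤ d →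
      1 - ENNReal.ofReal ((d : ℝ) ^ (-k)) ≤
        ((gaussianMatrix (p d) d).prod (Measure.pi fun _ : Fin (n d) => P d))
          {ω | ∀ Xh : Fin (n d) → Fin d → ℝ,
              (∀ j, eNorm (Xh j) = Real.sqrt d) →
              (∀ i, featureMap φ ω.1 (ω.2 i) ∈
                Submodule.span ℝ (Set.range fun j => featureMap φ ω.1 (Xh j))) →
              ∀ jh : Fin (n d), ∃ i : Fin (n d),
                eNorm (Xh jh - ω.2 i) ≤ η * Real.sqrt d} := by
  intro η hη k hk
  rw [← eventually_atTop]
  obtain ⟨L, hL⟩ := hφ.lipschitz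
  have hφc : Continuous φ := hL.continuous
  obtain ⟨l, l', hl, hl', hpar, hμ, hμ'⟩ := hφ.parity
  set Λ : ℝ := (L : ℝ) + |φ 0| + 1 with hΛdef
  have hL0 : (0:ℝ) ≤ L := L.2
  have hΛ : 0 < Λ := by positivity
  have hLip : ∀ s t, |φ s - φ t| ≤ Λ * |s - t| := by
    intro s t
    have h1 := hL.dist_le_mul s t
    rw [Real.dist_eq, Real.dist_eq] at h1
    refine h1.trans (mul_le_mul_of_nonneg_right ?_ (abs_nonneg _))
    have := abs_nonneg (φ 0)
    linarith
  have hb : ∀ t, |φ t| ≤ Λ * (1 + |t|) := by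
    intro t
    have h1 := hLip t 0
    rw [sub_zero] at h1
    have h2 : |φ t| ≤ |φ t - φ 0| + |φ 0| := by
      have := abs_add_le (φ t - φ 0) (φ 0)
      simpa using this
    have h3 : |φ 0| ≤ Λ := by linarith
    linarith
  have hφL := growth_memLp hφc hb
  obtain ⟨lam, hlam, hi⟩ := exists_exp_sq hφc hΛ hb
  obtain ⟨δ, hδ, hδ1, hker⟩ := ker2_bound (A := hermiteCoeff φ l ^ 2) (B := hermiteCoeff φ l' ^ 2)
    (by positivity) (by positivity) hl hl' hpar (by positivity : 0 < η ^ 2 / 2)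
  set δ₀ := (hermiteCoeff φ l ^ 2 + hermiteCoeff φ l' ^ 2) * (δ / 2) with hδ₀
  have hδ₀p : 0 < δ₀ := by positivity
  set I := ∫ g, Real.exp (lam * φ g ^ 2) ∂gam with hI
  have hI0 : 0 ≤ I := integral_nonneg fun g => (Real.exp_pos _).le
  set C := max C₀ 1 with hC
  have hC1 : 1 ≤ C := le_max_right _ _
  have hnC : ∀ d : ℕ, (n d : ℝ) ≤ C * d := fun d =>
    (hn d).trans (mul_le_mul_of_nonneg_right (le_max_left _ _) (by positivity))
  set c := δ₀ * lam / 16 with hc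
  have hcp : 0 < c := by positivity
  filter_upwards [num_event hlam hΛ hI0 hδ₀p hδ hC1, num_data (K := K) (C := C) (k := k) hC1,
    hp.eventually_ge_atTop ((8 * (2 + C) + k + 1) / c)] with d e1 e2 e3
  obtain ⟨hd, hτ1, e1⟩ := e1
  set τ := (d:ℝ) ^ (-(2/5) : ℝ) with hτ
  have hτ0 : 0 ≤ τ := by positivity
  have hd0 : 0 < d := by omega
  have hl0 : 0 < Real.log d := Real.log_pos (by exact_mod_cast (by omega : 1 < d))
  have hM : 0 < (8 * (2 + C) + k + 1) / c := by positivity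
  have hn1 : 1 ≤ n d := by
    by_contra hcon
    have h0 : n d = 0 := by omega
    rw [h0] at e3
    simp only [Nat.cast_zero, zero_mul, div_zero] at e3
    linarith
  have hnp : (0:ℝ) < n d := by exact_mod_cast hn1
  have hdp : (0:ℝ) < d := by exact_mod_cast hd0
  have hp' : (8 * (2 + C) + k + 1) / c * ((n d : ℝ) * d * Real.log d ^ 2) ≤ p d := by
    rwa [le_div_iff₀ (by positivity)] at e3
  obtain ⟨a1, a2, a3⟩ := e1 (n d) hn1 (hnC d)
  have := (hdata d).prob
  have : IsProbabilityMeasure (gaussianMatrix (p d) d) := by unfold gaussianMatrix; infer_instance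
  set ν := (Measure.pi fun _ : Fin (n d) => P d) with hν
  set S := {ω : (Fin (p d) → Fin d → ℝ) × (Fin (n d) → Fin d → ℝ) | ∀ Xh : Fin (n d) → Fin d → ℝ,
              (∀ j, eNorm (Xh j) = Real.sqrt d) →
              (∀ i, featureMap φ ω.1 (ω.2 i) ∈
                Submodule.span ℝ (Set.range fun j => featureMap φ ω.1 (Xh j))) →
              ∀ jh : Fin (n d), ∃ i : Fin (n d),
                eNorm (Xh jh - ω.2 i) ≤ η * Real.sqrt d} with hS
  have hbad : ((gaussianMatrix (p d) d).prod ν) (badSet φ (p d) d (n d) η τ) ≤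
      ENNReal.ofReal ((d:ℝ) ^ (-k) / 2) := by
    rw [Measure.prod_apply_symm (badSet_closed hφc _ _ _ _ _).measurableSet]
    calc _ ≤ ∫⁻ X, ENNReal.ofReal ((d:ℝ) ^ (-k) / 2) ∂ν := by
          apply lintegral_mono
          intro X
          by_cases hX : Xgood τ X
          · have hV := V_bound (η := η) (s := 2 / lam * Real.log d) (q := c / (n d * Real.log d))
              hφc hφL hΛ hb hLip hlam hi hδ₀p (by positivity) hd0 X hX.1
              (fun z hz => comb_second_moment hφc hφL hl hl' (by rintro rfl; exact hpar rfl) hμ hμ' hδ hδ1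
                hker hτ0 hτ1 hd0 a1 X hX z hz) a2 a3 (p d)
            refine le_trans (measure_mono ?_) (hV.trans (num_union hcp hk hd hn1 (hnC d) hp'))
            intro V hV
            exact hV.2
          · have : (fun x => (x, X)) ⁻¹' badSet φ (p d) d (n d) η τ = ∅ := by
              ext V
              simp only [Set.mem_preimage, Set.mem_empty_iff_false, iff_false]
              exact fun h => hX h.1
            simp only [this, measure_empty, zero_le]
      _ = _ := by simp
  have hgood : ((gaussianMatrix (p d) d).prod ν) (Set.univ ×ˢ {X | ¬ Xgood τ X}) ≤
      ENNReal.ofReal ((d:ℝ) ^ (-k) / 2) := by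
    rw [Measure.prod_prod, measure_univ, one_mul]
    exact (data_bound hd0 (hdata d) hτ0).trans (ENNReal.ofReal_le_ofReal (e2 (n d) (hnC d)))
  have hcover : (Set.univ : Set ((Fin (p d) → Fin d → ℝ) × (Fin (n d) → Fin d → ℝ))) ⊆
      S ∪ (badSet φ (p d) d (n d) η τ ∪ Set.univ ×ˢ {X | ¬ Xgood τ X}) := by
    intro ω _
    by_cases h1 : ω ∈ badSet φ (p d) d (n d) η τ
    · exact Or.inr (Or.inl h1)
    by_cases h2 : Xgood τ ω.2
    · exact Or.inl fun Xh hX hs jh => good_sub φ hη ω h2 h1 Xh hX hs jh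
    · exact Or.inr (Or.inr ⟨trivial, h2⟩)
  have hfin := measure_mono (μ := (gaussianMatrix (p d) d).prod ν) hcover
  rw [measure_univ] at hfin
  rw [tsub_le_iff_right]
  refine hfin.trans ((measure_union_le _ _).trans ?_)
  gcongr
  refine (measure_union_le _ _).trans ((add_le_add hbad hgood).trans ?_)
  rw [← ENNReal.ofReal_add (by positivity) (by positivity), add_halves]
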